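/- Let (φ₁,ψ₁) and (φ₂,ψ₂) belong to H²(ℝ₊)×H¹(ℝ₊) and satisfy the compatibility conditions φ₁(0) = φ₂(0), ψ₁(0) = φ₂′(0), and ψ₂(0) = φ₁′(0). Then there exists ζ ∈ H^{5/2}(ℝ₊×ℝ₊) such that (ζ, ∂ζ/∂x_i) = (φ_i, ψ_i) on the boundary portion where x_i = 0, for i = 1, 2. -/

import Mathlib

open MeasureTheory Real Set
open scoped RealInnerProductSpace
noncomputable section

abbrev E2 := EuclideanSpace ℝ (Fin 2)
def stdb2 (i : Fin 2) : E2 := EuclideanSpace.single i 1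
def L2on {n : ℕ} (Ω : Set (EuclideanSpace ℝ (Fin n))) (u : EuclideanSpace ℝ (Fin n) → ℝ) : Prop :=
  MemLp u 2 (volume.restrict Ω)
def IsWeakD {n : ℕ} (Ω : Set (EuclideanSpace ℝ (Fin n)))
    (u v : EuclideanSpace ℝ (Fin n) → ℝ) (d : EuclideanSpace ℝ (Fin n)) : Prop :=
  ∀ φ : EuclideanSpace ℝ (Fin n) → ℝ, ContDiff ℝ (⊤ : ℕ∞) φ → HasCompactSupport φ → tsupport φ ⊆ Ω →
    ∫ x in Ω, u x * fderiv ℝ φ x d = - ∫ x in Ω, v x * φ x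
def tri (p : Fin 3 → E2) : Set E2 := interior (convexHull ℝ (range p))
def evec (p : Fin 3 → E2) (i : Fin 3) : E2 := p (i + 2) - p (i + 1)
def elen (p : Fin 3 → E2) (i : Fin 3) : ℝ := ‖evec p i‖
def tangv (p : Fin 3 → E2) (i : Fin 3) : E2 := (elen p i)⁻¹ • evec p i
def norv (p : Fin 3 → E2) (i : Fin 3) : E2 :=
  EuclideanSpace.single 0 (tangv p i 1) + EuclideanSpace.single 1 (-(tangv p i 0))
def epar (p : Fin 3 → E2) (i : Fin 3) (t : ℝ) : E2 := p (i + 1) + t • evec p i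
def ccw (p : Fin 3 → E2) : Prop :=
  0 < (p 1 - p 0) 0 * (p 2 - p 0) 1 - (p 1 - p 0) 1 * (p 2 - p 0) 0
def tau (i j : Fin 3) : ℝ := if i = j + 1 then 0 else 1

/-- weak derivative on an open interval of `ℝ` -/
def IsWeakD1 (S : Set ℝ) (u v : ℝ → ℝ) : Prop :=
  ∀ φ : ℝ → ℝ, ContDiff ℝ (⊤ : ℕ∞) φ → HasCompactSupport φ → tsupport φ ⊆ S →
    ∫ t in S, u t * deriv φ t = - ∫ t in S, v t * φ t

def MemHedge : ℕ → (ℝ → ℝ) → Prop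
  | 0, u => MemLp u 2 (volume.restrict (Ioo (0:ℝ) 1))
  | (k+1), u => MemLp u 2 (volume.restrict (Ioo (0:ℝ) 1)) ∧
      ∃ v, IsWeakD1 (Ioo (0:ℝ) 1) u v ∧ MemHedge k v

/-- membership of edgewise data in `H²(∂T) × H¹(∂T)` (with pointwise C¹/C⁰ representatives) -/
def MemBdryH2H1 (f g : Fin 3 → ℝ → ℝ) : Prop :=
  ∀ i, MemHedge 2 (f i) ∧ ContDiffOn ℝ 1 (f i) (Icc 0 1) ∧
    MemHedge 1 (g i) ∧ ContinuousOn (g i) (Icc 0 1)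

/-- compatibility conditions (2.2)-(2.4) -/
def Compat (p : Fin 3 → E2) (f g : Fin 3 → ℝ → ℝ) : Prop :=
  (∀ i j k : Fin 3, j ≠ i → k ≠ i → f j (tau i j) = f k (tau i k)) ∧
  ∃ w : Fin 3 → E2, ∀ i j : Fin 3, j ≠ i →
    derivWithin (f j) (Icc 0 1) (tau i j) = elen p j * ⟪w i, tangv p j⟫ ∧
    g j (tau i j) = ⟪w i, norv p j⟫

/-- `H²` membership with explicit weak gradient and Hessian data -/
def MemH2W {n : ℕ} (Ω : Set (EuclideanSpace ℝ (Fin n))) (ξ : EuclideanSpace ℝ (Fin n) → ℝ)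
    (G : Fin n → EuclideanSpace ℝ (Fin n) → ℝ)
    (Hs : Fin n → Fin n → EuclideanSpace ℝ (Fin n) → ℝ) : Prop :=
  L2on Ω ξ ∧ (∀ d, L2on Ω (G d) ∧ IsWeakD Ω ξ (G d) (EuclideanSpace.single d 1)) ∧
  ∀ d d', L2on Ω (Hs d d') ∧ IsWeakD Ω (G d) (Hs d d') (EuclideanSpace.single d' 1)

/-- Gagliardo-type `H^{1/2}` seminorm finiteness for functions on a domain in `ℝⁿ` -/
def GagH12 {n : ℕ} (Ω : Set (EuclideanSpace ℝ (Fin n))) (u : EuclideanSpace ℝ (Fin n) → ℝ) : Prop :=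
  Integrable (fun q : EuclideanSpace ℝ (Fin n) × EuclideanSpace ℝ (Fin n) =>
    (u q.1 - u q.2) ^ 2 / ‖q.1 - q.2‖ ^ (n + 1)) ((volume.restrict Ω).prod (volume.restrict Ω))

/-- membership in `H^{5/2}` of a domain: weak `H²` data whose second derivatives have finite
`H^{1/2}` Gagliardo seminorm. -/
def MemH52 {n : ℕ} (Ω : Set (EuclideanSpace ℝ (Fin n))) (ζ : EuclideanSpace ℝ (Fin n) → ℝ) : Prop :=
  ∃ G Hs, MemH2W Ω ζ G Hs ∧ ∀ d d', GagH12 Ω (Hs d d')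

/-- pointwise trace relation `Tr ζ = (f,g)` on `∂T` for a `C¹` function -/
def TraceEq (p : Fin 3 → E2) (ζ : E2 → ℝ) (f g : Fin 3 → ℝ → ℝ) : Prop :=
  ∀ i : Fin 3, ∀ t ∈ Icc (0:ℝ) 1,
    ζ (epar p i t) = f i t ∧ fderiv ℝ ζ (epar p i t) (norv p i) = g i t

/-- membership in `H²(ℝ₊)` with explicit weak derivatives -/
def MemH2halfline (φ φ₁ φ₂ : ℝ → ℝ) : Prop :=
  MemLp φ 2 (volume.restrict (Ioi (0:ℝ))) ∧ MemLp φ₁ 2 (volume.restrict (Ioi (0:ℝ))) ∧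
    MemLp φ₂ 2 (volume.restrict (Ioi (0:ℝ))) ∧
    IsWeakD1 (Ioi 0) φ φ₁ ∧ IsWeakD1 (Ioi 0) φ₁ φ₂

/-- membership in `H¹(ℝ₊)` with explicit weak derivative -/
def MemH1halfline (ψ ψ₁ : ℝ → ℝ) : Prop :=
  MemLp ψ 2 (volume.restrict (Ioi (0:ℝ))) ∧ MemLp ψ₁ 2 (volume.restrict (Ioi (0:ℝ))) ∧
    IsWeakD1 (Ioi 0) ψ ψ₁

/-- the open quadrant `ℝ₊ × ℝ₊` -/
def quadrant : Set E2 := {x : E2 | 0 < x 0 ∧ 0 < x 1}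

section part1
open scoped RealInnerProductSpace

open FourierTransform in
theorem fourier_ae_eq (f : ℝ → ℂ) (h1 : Integrable f) (h2 : MemLp f 2) :
    (((𝓕 (h2.toLp f) : Lp ℂ 2 (volume : Measure ℝ))) : ℝ → ℂ) =ᵐ[volume] 𝓕 f := by
  apply ae_eq_of_integral_contDiff_smul_eq
  · exact (Lp.memLp _).locallyIntegrable (by norm_num)
  · apply Continuous.locallyIntegrable
    exact VectorFourier.fourierIntegral_continuous Real.continuous_fourierChar
      (by exact (innerSL ℝ).continuous₂) h1
  · intro g hg hgc
    have hgC : ContDiff ℝ (⊤ : ℕ∞) (fun x => (g x : ℂ)) := Complex.ofRealCLM.contDiff.comp hg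
    have hgcC : HasCompactSupport (fun x => (g x : ℂ)) := hgc.comp_left (g := fun x : ℝ => (x : ℂ)) (by simp)
    set G := hgcC.toSchwartzMap hgC
    have hG : ∀ x, G x = (g x : ℂ) := fun x => rfl
    have e1 := Lp.toTemperedDistribution_apply (𝓕 (h2.toLp f)) G
    rw [← Lp.fourier_toTemperedDistribution_eq, TemperedDistribution.fourier_apply,
      Lp.toTemperedDistribution_apply] at e1
    have e2 : ∫ x, (𝓕 G) x • (h2.toLp f : ℝ → ℂ) x = ∫ x, (𝓕 G) x • f x := by
      apply integral_congr_ae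
      filter_upwards [h2.coeFn_toLp] with x hx
      rw [hx]
    have e3 : ∫ x, (𝓕 (G : ℝ → ℂ)) x • f x = ∫ x, G x • (𝓕 f) x := by
      have := VectorFourier.integral_fourierIntegral_smul_eq_flip (μ := volume) (ν := volume)
        (L := innerₗ ℝ) Real.continuous_fourierChar
        (by exact (innerSL ℝ).continuous₂) G.integrable h1
      rw [flip_innerₗ] at this
      exact this
    rw [e2, SchwartzMap.fourier_coe, e3] at e1
    simpa [hG] using e1.symm

open FourierTransform in
theorem plancherel (f : ℝ → ℂ) (h1 : Integrable f) (h2 : MemLp f 2) :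
    ∫⁻ x, ‖f x‖ₑ ^ 2 = ∫⁻ x, ‖(𝓕 f) x‖ₑ ^ 2 := by
  have h := Lp.norm_fourier_eq (h2.toLp f)
  rw [Lp.norm_def, Lp.norm_def, ENNReal.toReal_eq_toReal_iff' (Lp.memLp _).2.ne (Lp.memLp _).2.ne,
    eLpNorm_congr_ae (fourier_ae_eq f h1 h2), eLpNorm_congr_ae h2.coeFn_toLp,
    eLpNorm_eq_lintegral_rpow_enorm_toReal (by norm_num) (by norm_num),
    eLpNorm_eq_lintegral_rpow_enorm_toReal (by norm_num) (by norm_num)] at h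
  have := ENNReal.rpow_left_injective (x := 1/(2:ENNReal).toReal) (by norm_num) h
  simpa using this.symm

end part1

section part2
open scoped RealInnerProductSpace FourierTransform

theorem lint_scale (f : ℝ → ENNReal) (hf : Measurable f) (c : ℝ) (hc : c ≠ 0) :
    ∫⁻ x, f (c * x) = ‖c‖ₑ⁻¹ * ∫⁻ x, f x := by
  have h := lintegral_map (μ := volume) hf (measurable_const_mul c)
  rw [← h, Real.map_volume_mul_left hc, lintegral_smul_measure, abs_inv, smul_eq_mul,
    ENNReal.ofReal_inv_of_pos (abs_pos.2 hc), Real.enorm_eq_ofReal_abs]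

theorem inv_one_add_sq_lint : ∫⁻ u : ℝ, ENNReal.ofReal ((1 + u^2)⁻¹) = ENNReal.ofReal π := by
  rw [← ofReal_integral_eq_lintegral_ofReal integrable_inv_one_add_sq
    (Filter.Eventually.of_forall fun x => by positivity), integral_univ_inv_one_add_sq]

theorem echar_norm_le (u : ℝ) : ‖(𝐞 u : ℂ) - 1‖ ≤ 2 * π * |u| := by
  have h := Real.norm_exp_I_mul_ofReal_sub_one_le (x := 2 * π * u)
  rw [Real.fourierChar_apply, mul_comm _ Complex.I]
  refine h.trans ?_
  rw [norm_mul, norm_mul, Real.norm_eq_abs, Real.norm_eq_abs, Real.norm_eq_abs,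
    abs_of_pos Real.pi_pos, abs_of_pos (by norm_num : (0:ℝ) < 2)]

theorem echar_norm_le_two (u : ℝ) : ‖(𝐞 u : ℂ) - 1‖ ≤ 2 := by
  refine (norm_sub_le _ _).trans ?_
  rw [Circle.norm_coe, norm_one]; norm_num

theorem echar_meas : Measurable (fun u : ℝ => (𝐞 u : ℂ)) :=
  (continuous_subtype_val.comp Real.continuous_fourierChar).measurable

def Dint : ENNReal := ∫⁻ u : ℝ, ‖(𝐞 u : ℂ) - 1‖ₑ ^ 2 / ‖u‖ₑ ^ 2

theorem ensq_eq (z : ℂ) : ‖z‖ₑ ^ 2 = ENNReal.ofReal (‖z‖ ^ 2) := by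
  rw [← ofReal_norm, ENNReal.ofReal_pow (norm_nonneg _)]
theorem ensq_eqR (z : ℝ) : ‖z‖ₑ ^ 2 = ENNReal.ofReal (z ^ 2) := by
  rw [← ofReal_norm, ← ENNReal.ofReal_pow (norm_nonneg _), Real.norm_eq_abs, sq_abs]

theorem Dint_lt : Dint < ⊤ := by
  have : Dint ≤ ∫⁻ u : ℝ, ENNReal.ofReal (8 * π ^ 2) * ENNReal.ofReal ((1 + u^2)⁻¹) := by
    unfold Dint
    apply lintegral_mono
    intro u
    rcases eq_or_ne u 0 with rfl | hu
    · simp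
    simp only
    rw [ensq_eq, ensq_eqR, ← ENNReal.ofReal_div_of_pos (by positivity), ← ENNReal.ofReal_mul (by positivity)]
    apply ENNReal.ofReal_le_ofReal
    have h1 := echar_norm_le u
    have h2 := echar_norm_le_two u
    have h0 := norm_nonneg ((𝐞 u : ℂ) - 1)
    have hu2 : 0 < u ^ 2 := by positivity
    rw [← div_eq_mul_inv, div_le_div_iff₀ hu2 (by positivity)]
    have a1 : ‖(𝐞 u : ℂ) - 1‖ ^ 2 ≤ (2 * π * |u|)^2 := pow_le_pow_left₀ h0 h1 2
    have a2 : ‖(𝐞 u : ℂ) - 1‖ ^ 2 ≤ 2^2 := pow_le_pow_left₀ h0 h2 2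
    have a3 : (2 * π * |u|)^2 = 4 * π^2 * u^2 := by rw [mul_pow, sq_abs]; ring
    have hp : 3 < π := Real.pi_gt_three
    have : 9 ≤ π^2 := by nlinarith
    nlinarith
  refine this.trans_lt ?_
  rw [lintegral_const_mul' _ _ ENNReal.ofReal_ne_top, inv_one_add_sq_lint]
  exact ENNReal.mul_lt_top ENNReal.ofReal_lt_top ENNReal.ofReal_lt_top

theorem Dlem (ξ : ℝ) : ∫⁻ h : ℝ, ‖(𝐞 (ξ * h) : ℂ) - 1‖ₑ ^ 2 / ‖h‖ₑ ^ 2 = Dint * ‖ξ‖ₑ := by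
  rcases eq_or_ne ξ 0 with rfl | hξ
  · simp
  have hm : Measurable (fun u : ℝ => ‖(𝐞 u : ℂ) - 1‖ₑ ^ 2 / ‖u‖ₑ ^ 2) :=
    ((echar_meas.sub_const 1).enorm.pow_const 2).div (measurable_enorm.pow_const 2)
  have h := lint_scale _ hm ξ hξ
  have h0 : ‖ξ‖ₑ ≠ 0 := by simpa using hξ
  have ht : ‖ξ‖ₑ ≠ ⊤ := by simp
  calc _ = ∫⁻ h : ℝ, ‖ξ‖ₑ^2 * (‖(𝐞 (ξ * h) : ℂ) - 1‖ₑ ^ 2 / ‖ξ * h‖ₑ ^ 2) := by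
        congr 1; ext h
        rw [enorm_mul, mul_pow, ENNReal.div_eq_inv_mul, ENNReal.div_eq_inv_mul,
          ENNReal.mul_inv (by left; simpa using hξ) (by left; simp), ← mul_assoc, ← mul_assoc,
          ENNReal.mul_inv_cancel (by simpa using hξ) (by simp), one_mul]
    _ = _ := by
        rw [lintegral_const_mul' _ _ (by simp), h, ← mul_assoc, mul_comm, sq, mul_assoc,
          ENNReal.mul_inv_cancel h0 ht, mul_one]; rfl

/-- the kernel `r^{-3}` -/
def kap (s t : ℝ) : ENNReal := ENNReal.ofReal (1 / (√(s^2+t^2))^3)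

theorem kap_meas : Measurable (fun p : ℝ × ℝ => kap p.1 p.2) := by
  unfold kap
  fun_prop

theorem kap_lint (s : ℝ) : ∫⁻ t, kap s t ≤ ENNReal.ofReal π / ‖s‖ₑ ^ 2 := by
  rcases eq_or_ne s 0 with rfl | hs
  · simp [ENNReal.div_zero, Real.pi_pos]
  have hm : Measurable (fun u : ℝ => ENNReal.ofReal ((1 + u^2)⁻¹)) := by fun_prop
  have h := lint_scale _ hm s⁻¹ (inv_ne_zero hs)
  have : ∀ t, kap s t ≤ (‖s‖ₑ ^ 3)⁻¹ * ENNReal.ofReal ((1 + (s⁻¹ * t)^2)⁻¹) := by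
    intro t
    have h0 : 0 < |s| := abs_pos.2 hs
    have h1 : 0 < s^2 + t^2 := by positivity
    have hle : |s| ≤ √(s^2+t^2) := by
      apply Real.le_sqrt_of_sq_le; rw [sq_abs]; nlinarith [sq_nonneg t]
    have hsq : √(s^2+t^2) ^ 2 = s^2+t^2 := Real.sq_sqrt h1.le
    have e : (‖s‖ₑ ^ 3)⁻¹ = ENNReal.ofReal ((|s|^3)⁻¹) := by
      rw [Real.enorm_eq_ofReal_abs, ← ENNReal.ofReal_pow h0.le, ENNReal.ofReal_inv_of_pos (by positivity)]
    rw [e, ← ENNReal.ofReal_mul (by positivity)]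
    apply ENNReal.ofReal_le_ofReal
    have e2 : (|s|^3)⁻¹ * (1 + (s⁻¹ * t)^2)⁻¹ = 1 / (|s| * (s^2+t^2)) := by
      have : |s|^3 = |s| * s^2 := by rw [pow_succ, sq_abs]; ring
      rw [this]; field_simp
    rw [e2]
    apply one_div_le_one_div_of_le (by positivity)
    rw [pow_succ (√(s^2+t^2)), hsq, mul_comm]
    exact mul_le_mul_of_nonneg_left hle h1.le
  refine (lintegral_mono this).trans ?_
  rw [lintegral_const_mul _ (by fun_prop), h, inv_one_add_sq_lint, enorm_inv hs, inv_inv, ENNReal.div_eq_inv_mul,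
    ← mul_assoc]
  gcongr
  have h0 : ‖s‖ₑ ≠ 0 := by simpa using hs
  have ht : ‖s‖ₑ ≠ ⊤ := by simp
  rw [pow_succ, ENNReal.mul_inv (by right; simp) (by left; simp), mul_assoc, ENNReal.inv_mul_cancel h0 ht, mul_one]

theorem kap_meas' {α : Type*} [MeasurableSpace α] {f g : α → ℝ} (hf : Measurable f) (hg : Measurable g) :
    Measurable (fun x => kap (f x) (g x)) := by
  unfold kap
  fun_prop

theorem w_meas' {w : ℝ → ℝ → ℝ} (hw : Measurable (Function.uncurry w))
    {α : Type*} [MeasurableSpace α] {f g : α → ℝ} (hf : Measurable f) (hg : Measurable g) :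
    Measurable (fun x => w (f x) (g x)) := hw.comp (hf.prodMk hg)

theorem wsq_meas {w : ℝ → ℝ → ℝ} (hw : Measurable (Function.uncurry w))
    {α : Type*} [MeasurableSpace α] {f g f' g' : α → ℝ} (hf : Measurable f) (hg : Measurable g)
    (hf' : Measurable f') (hg' : Measurable g') :
    Measurable (fun x => ‖w (f x) (g x) - w (f' x) (g' x)‖ₑ ^ 2) :=
  ((w_meas' hw hf hg).sub (w_meas' hw hf' hg')).enorm.pow_const 2

theorem kap_neg (s t : ℝ) : kap (-s) t = kap s t := by simp [kap]
theorem kap_swap (s t : ℝ) : kap s t = kap t s := by simp [kap, add_comm]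

def NG (w : ℝ → ℝ → ℝ) : ENNReal :=
  ∫⁻ p : ℝ × ℝ, ∫⁻ q : ℝ × ℝ, ‖w p.1 p.2 - w q.1 q.2‖ₑ ^ 2 * kap (p.1 - q.1) (p.2 - q.2)
def AG (w : ℝ → ℝ → ℝ) : ENNReal :=
  ∫⁻ a, ∫⁻ a', ∫⁻ b, ‖w a b - w a' b‖ₑ ^ 2 / ‖a - a'‖ₑ ^ 2
def BG (w : ℝ → ℝ → ℝ) : ENNReal :=
  ∫⁻ a, ∫⁻ b, ∫⁻ b', ‖w a b - w a b'‖ₑ ^ 2 / ‖b - b'‖ₑ ^ 2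

theorem sq_split (x y z : ℝ) : ‖x - z‖ₑ ^ 2 ≤ 2 * ‖x - y‖ₑ ^ 2 + 2 * ‖y - z‖ₑ^2 := by
  have : x - z = (x - y) + (y - z) := by ring
  rw [this, ensq_eqR, ensq_eqR, ensq_eqR]
  generalize x - y = u; generalize y - z = v
  rw [show (2:ENNReal) = ENNReal.ofReal 2 by simp, ← ENNReal.ofReal_mul (by norm_num), ← ENNReal.ofReal_mul (by norm_num),
    ← ENNReal.ofReal_add (by positivity) (by positivity)]
  apply ENNReal.ofReal_le_ofReal
  nlinarith [sq_nonneg (u - v)]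


theorem m1_meas (w : ℝ → ℝ → ℝ) (hw : Measurable (Function.uncurry w)) :
    Measurable (fun x : (ℝ × ℝ) × (ℝ × ℝ) => ‖w x.1.1 x.1.2 - w x.2.1 x.1.2‖ₑ ^ 2 *
      kap (x.1.1 - x.2.1) (x.1.2 - x.2.2)) := by
  apply Measurable.fun_mul
  · exact wsq_meas hw (by fun_prop) (by fun_prop) (by fun_prop) (by fun_prop)
  · exact kap_meas' (by fun_prop) (by fun_prop)

theorem m2_meas (w : ℝ → ℝ → ℝ) (hw : Measurable (Function.uncurry w)) :
    Measurable (fun x : (ℝ × ℝ) × (ℝ × ℝ) => ‖w x.2.1 x.1.2 - w x.2.1 x.2.2‖ₑ ^ 2 *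
      kap (x.1.1 - x.2.1) (x.1.2 - x.2.2)) := by
  apply Measurable.fun_mul
  · exact wsq_meas hw (by fun_prop) (by fun_prop) (by fun_prop) (by fun_prop)
  · exact kap_meas' (by fun_prop) (by fun_prop)

theorem m2_meas' (w : ℝ → ℝ → ℝ) (hw : Measurable (Function.uncurry w)) :
    Measurable (fun x : (ℝ × ℝ) × (ℝ × ℝ) => ‖w x.1.1 x.2.2 - w x.1.1 x.1.2‖ₑ ^ 2 *
      kap (x.2.1 - x.1.1) (x.2.2 - x.1.2)) := by
  apply Measurable.fun_mul
  · exact wsq_meas hw (by fun_prop) (by fun_prop) (by fun_prop) (by fun_prop)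
  · exact kap_meas' (by fun_prop) (by fun_prop)

theorem NG_A (w : ℝ → ℝ → ℝ) (hw : Measurable (Function.uncurry w)) :
    (∫⁻ p : ℝ × ℝ, ∫⁻ q : ℝ × ℝ, ‖w p.1 p.2 - w q.1 p.2‖ₑ ^ 2 * kap (p.1 - q.1) (p.2 - q.2)) ≤
      ENNReal.ofReal π * AG w := by
  rw [Measure.volume_eq_prod, lintegral_prod _ (by exact (m1_meas w hw).lintegral_prod_right'.aemeasurable)]
  unfold AG
  rw [← lintegral_const_mul' _ _ (by simp)]
  apply lintegral_mono; intro a; simp only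
  rw [← lintegral_const_mul' _ _ (by simp)]
  have : ∀ b, ∫⁻ q : ℝ × ℝ, ‖w a b - w q.1 b‖ₑ ^ 2 * kap (a - q.1) (b - q.2) ∂(volume.prod volume) =
      ∫⁻ a', ‖w a b - w a' b‖ₑ ^ 2 * ∫⁻ t, kap (a - a') t := by
    intro b
    rw [lintegral_prod _ (by exact ((wsq_meas hw (by fun_prop) (by fun_prop) (by fun_prop) (by fun_prop)).fun_mul (kap_meas' (by fun_prop) (by fun_prop))).aemeasurable)]
    congr 1; ext a'
    simp only
    rw [lintegral_const_mul' _ _ (by simp)]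
    congr 1
    exact lintegral_sub_left_eq_self (fun t => kap (a - a') t) b
  simp_rw [this]
  rw [lintegral_lintegral_swap]
  swap
  · apply Measurable.aemeasurable
    apply Measurable.fun_mul
    · exact wsq_meas hw (by fun_prop) (by fun_prop) (by fun_prop) (by fun_prop)
    · exact Measurable.lintegral_prod_right' (f := fun x : (ℝ × ℝ) × ℝ => kap (a - x.1.2) x.2)
        (kap_meas' (by fun_prop) (by fun_prop))
  apply lintegral_mono; intro a'; simp only
  rw [← lintegral_const_mul' _ _ (by simp)]
  apply lintegral_mono; intro b; simp only
  calc _ ≤ ‖w a b - w a' b‖ₑ ^ 2 * (ENNReal.ofReal π / ‖a - a'‖ₑ ^ 2) := by gcongr; exact kap_lint _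
    _ = _ := by rw [ENNReal.div_eq_inv_mul, ENNReal.div_eq_inv_mul]; ring

theorem NG_B (w : ℝ → ℝ → ℝ) (hw : Measurable (Function.uncurry w)) :
    (∫⁻ p : ℝ × ℝ, ∫⁻ q : ℝ × ℝ, ‖w q.1 p.2 - w q.1 q.2‖ₑ ^ 2 * kap (p.1 - q.1) (p.2 - q.2)) ≤
      ENNReal.ofReal π * BG w := by
  rw [lintegral_lintegral_swap (m2_meas w hw).aemeasurable]
  rw [Measure.volume_eq_prod, lintegral_prod _ (by exact (m2_meas' w hw).lintegral_prod_right'.aemeasurable)]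
  unfold BG
  rw [← lintegral_const_mul' _ _ (by simp)]
  apply lintegral_mono; intro a; simp only
  rw [← lintegral_const_mul' _ _ (by simp)]
  apply lintegral_mono; intro b; simp only
  rw [lintegral_prod_symm _ (by exact ((wsq_meas hw (by fun_prop) (by fun_prop) (by fun_prop) (by fun_prop)).fun_mul (kap_meas' (by fun_prop) (by fun_prop))).aemeasurable)]
  rw [← lintegral_const_mul' _ _ (by simp)]
  apply lintegral_mono; intro b'; simp only
  rw [lintegral_const_mul' _ _ (by simp)]
  have e : ∫⁻ x, kap (x - a) (b' - b) = ∫⁻ x, kap (b' - b) x := by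
    simp_rw [kap_swap _ (b' - b)]
    exact lintegral_sub_right_eq_self (fun t => kap (b' - b) t) a
  rw [e]
  calc _ ≤ ‖w a b' - w a b‖ₑ ^ 2 * (ENNReal.ofReal π / ‖b' - b‖ₑ ^ 2) := by gcongr; exact kap_lint _
    _ = _ := by rw [ENNReal.div_eq_inv_mul, ENNReal.div_eq_inv_mul, enorm_sub_rev b' b, enorm_sub_rev (w a b')]; ring

theorem NG_le (w : ℝ → ℝ → ℝ) (hw : Measurable (Function.uncurry w)) :
    NG w ≤ 2 * ENNReal.ofReal π * (AG w + BG w) := by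
  have m1 := m1_meas w hw
  have step : NG w ≤ 2 * (∫⁻ p : ℝ × ℝ, ∫⁻ q : ℝ × ℝ, ‖w p.1 p.2 - w q.1 p.2‖ₑ ^ 2 * kap (p.1 - q.1) (p.2 - q.2)) +
      2 * (∫⁻ p : ℝ × ℝ, ∫⁻ q : ℝ × ℝ, ‖w q.1 p.2 - w q.1 q.2‖ₑ ^ 2 * kap (p.1 - q.1) (p.2 - q.2)) := by
    rw [← lintegral_const_mul' _ _ (by simp), ← lintegral_const_mul' _ _ (by simp),
      ← lintegral_add_left (by exact (m1.lintegral_prod_right').const_mul 2)]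
    apply lintegral_mono; intro p
    simp only
    rw [← lintegral_const_mul' _ _ (by simp), ← lintegral_const_mul' _ _ (by simp),
      ← lintegral_add_left (by exact (m1.comp (by fun_prop : Measurable fun q : ℝ × ℝ => (p, q))).const_mul 2)]
    apply lintegral_mono; intro q
    simp only
    rw [← mul_assoc, ← mul_assoc, ← add_mul]
    gcongr
    exact sq_split _ _ _
  refine step.trans ?_
  calc _ ≤ 2 * (ENNReal.ofReal π * AG w) + 2 * (ENNReal.ofReal π * BG w) := by
        gcongr
        · exact NG_A w hw
        · exact NG_B w hw
    _ = _ := by ring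

end part2

section part3
open scoped RealInnerProductSpace FourierTransform

def Tf (k g : ℝ → ℝ) (a b : ℝ) : ℝ := ∫ y, g (b + a * y) * k y
def Wf (m k g : ℝ → ℝ) (a b : ℝ) : ℝ := m a * Tf k g a b
def Kh (k : ℝ → ℝ) (t : ℝ) : ℂ := ∫ y, (𝐞 (t * y) : ℂ) * (k y : ℂ)

theorem Tf_smeas (k g : ℝ → ℝ) (hk : Measurable k) (hg : Measurable g) :
    Measurable (Function.uncurry (Tf k g)) := by
  have : StronglyMeasurable (fun x : (ℝ × ℝ) × ℝ => g (x.1.2 + x.1.1 * x.2) * k x.2) := by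
    apply Measurable.stronglyMeasurable
    exact (hg.comp (by fun_prop)).mul (hk.comp measurable_snd)
  exact (this.integral_prod_right').measurable

theorem Wf_meas (m k g : ℝ → ℝ) (hm : Measurable m) (hk : Measurable k) (hg : Measurable g) :
    Measurable (Function.uncurry (Wf m k g)) := by
  unfold Wf
  exact (hm.comp measurable_fst).mul (Tf_smeas k g hk hg)

theorem int2 (k g : ℝ → ℝ) (hk : Integrable k) (hkm : Measurable k) (hg : Measurable g) (hgi : Integrable g) (a : ℝ) :
    Integrable (fun p : ℝ × ℝ => g (p.1 + a * p.2) * k p.2) (volume.prod volume) := by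
  rw [integrable_prod_iff']
  · constructor
    · filter_upwards with y
      exact (hgi.comp_add_right (a * y)).mul_const _
    · have : (fun y => ∫ x, ‖g (x + a * y) * k y‖) = fun y => (∫ x, ‖g x‖) * ‖k y‖ := by
        ext y
        simp_rw [norm_mul]
        rw [integral_mul_const, integral_add_right_eq_self (fun x => ‖g x‖)]
      simp only
      rw [this]
      exact hk.norm.const_mul _
  · exact ((hg.comp (by fun_prop)).mul (hkm.comp measurable_snd)).aestronglyMeasurable

theorem Tf_int (k g : ℝ → ℝ) (hk : Integrable k) (hkm : Measurable k) (hg : Measurable g) (hgi : Integrable g) (a : ℝ) :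
    Integrable (Tf k g a) :=
  (int2 k g hk hkm hg hgi a).integral_prod_left

theorem Tf_bdd (k g : ℝ → ℝ) (hk : Integrable k) (M : ℝ) (hM : ∀ t, |g t| ≤ M) (a b : ℝ) :
    |Tf k g a b| ≤ M * ∫ y, |k y| := by
  unfold Tf
  rw [← Real.norm_eq_abs]
  refine (norm_integral_le_of_norm_le (hk.abs.const_mul M) ?_).trans_eq (integral_const_mul _ _)
  filter_upwards with y
  rw [norm_mul]
  exact mul_le_mul_of_nonneg_right (hM _) (norm_nonneg _)

theorem memLp2_of_bdd (f : ℝ → ℂ) (hf : Integrable f) (M : ℝ) (hM : ∀ t, ‖f t‖ ≤ M) : MemLp f 2 := by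
  rw [memLp_two_iff_integrable_sq_norm hf.1]
  refine (hf.norm.const_mul M).mono' (hf.1.norm.pow 2) ?_
  filter_upwards with t
  rw [Real.norm_eq_abs, abs_of_nonneg (by positivity), sq]
  exact mul_le_mul_of_nonneg_right (hM t) (norm_nonneg _)

theorem echar_norm1 (u : ℝ) : ‖(𝐞 u : ℂ)‖ = 1 := Circle.norm_coe _
theorem echar_smul (u : ℝ) (z : ℂ) : 𝐞 u • z = (𝐞 u : ℂ) * z := rfl
theorem ofReal_intg {k : ℝ → ℝ} (hk : Integrable k) : Integrable (fun y => (k y : ℂ)) := hk.ofReal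

theorem Tf_fourier (k g : ℝ → ℝ) (hk : Integrable k) (hkm : Measurable k) (hg : Measurable g) (hgi : Integrable g)
    (a ξ : ℝ) :
    𝓕 (fun b => (Tf k g a b : ℂ)) ξ = Kh k (a * ξ) * 𝓕 (fun b => (g b : ℂ)) ξ := by
  have hi := int2 k g hk hkm hg hgi a
  have hi2 : Integrable (fun p : ℝ × ℝ => (𝐞 (-(p.1 * ξ)) : ℂ) * ((g (p.1 + a * p.2) * k p.2 : ℝ) : ℂ)) (volume.prod volume) := by
    refine hi.norm.mono' ?_ ?_
    · refine AEStronglyMeasurable.mul ?_ hi.ofReal.1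
      exact (echar_meas.comp (by fun_prop)).aestronglyMeasurable
    · filter_upwards with p
      rw [norm_mul, echar_norm1, one_mul, Complex.norm_real]
  rw [Real.fourier_real_eq]
  calc _ = ∫ b, ∫ y, (𝐞 (-(b * ξ)) : ℂ) * ((g (b + a * y) * k y : ℝ) : ℂ) := by
        congr 1; ext b
        rw [echar_smul, integral_const_mul]
        congr 1
        exact (integral_ofReal (𝕜 := ℂ)).symm
    _ = ∫ y, ∫ b, (𝐞 (-(b * ξ)) : ℂ) * ((g (b + a * y) * k y : ℝ) : ℂ) := integral_integral_swap hi2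
    _ = ∫ y, ((𝐞 (a * ξ * y) : ℂ) * (k y : ℂ)) * 𝓕 (fun b => (g b : ℂ)) ξ := by
        congr 1; ext y
        rw [Real.fourier_real_eq, ← integral_const_mul,
          ← integral_add_right_eq_self (fun x => _ * (𝐞 (-(x * ξ)) • (g x : ℂ))) (a * y)]
        congr 1; ext b
        have : (𝐞 (-(b * ξ)) : ℂ) = 𝐞 (a * ξ * y) * 𝐞 (-((b + a * y) * ξ)) := by
          rw [← Circle.coe_mul, ← AddChar.map_add_eq_mul]; congr 2; ring
        rw [this, echar_smul]; push_cast; ring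
    _ = _ := by rw [integral_mul_const]; rfl

theorem Kh_eq (k : ℝ → ℝ) (t : ℝ) : Kh k t = 𝓕 (fun y => (k y : ℂ)) (-t) := by
  rw [Real.fourier_real_eq]; unfold Kh
  congr 1; ext y
  rw [echar_smul]; congr 3; ring

theorem Kh_cont (k : ℝ → ℝ) (hk : Integrable k) : Continuous (Kh k) := by
  have : Continuous (𝓕 (fun y => (k y : ℂ))) :=
    VectorFourier.fourierIntegral_continuous Real.continuous_fourierChar
      (by exact (innerSL ℝ).continuous₂) hk.ofReal
  have e : Kh k = fun t => 𝓕 (fun y => (k y : ℂ)) (-t) := funext (Kh_eq k)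
  rw [e]
  exact this.comp continuous_neg

theorem Kh_le (k : ℝ → ℝ) (t : ℝ) : ‖Kh k t‖ ≤ ∫ y, |k y| := by
  refine (norm_integral_le_integral_norm _).trans_eq ?_
  simp [echar_norm1]

theorem lint_neg (f : ℝ → ENNReal) : ∫⁻ x, f (-x) = ∫⁻ x, f x :=
  lintegral_neg_eq_self f

theorem Kh_planch (k : ℝ → ℝ) (hk : Integrable k) (M : ℝ) (hM : ∀ t, |k t| ≤ M) :
    ∫⁻ t, ‖Kh k t‖ₑ ^ 2 = ∫⁻ t, ‖k t‖ₑ ^ 2 := by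
  simp_rw [Kh_eq]
  rw [lint_neg (fun t => ‖𝓕 (fun y => (k y : ℂ)) t‖ₑ ^ 2), ← plancherel (fun y => (k y : ℂ)) (ofReal_intg hk)
    (memLp2_of_bdd _ (ofReal_intg hk) M (by simpa using hM))]
  simp [← ofReal_norm]

theorem Kh_diff (k : ℝ → ℝ) (hk : Integrable k) (M : ℝ) (hM : ∀ t, |k t| ≤ M) (h : ℝ) :
    ∫⁻ t, ‖Kh k (t + h) - Kh k t‖ₑ ^ 2 = ∫⁻ y, ‖(𝐞 (y * h) : ℂ) - 1‖ₑ ^ 2 * ‖k y‖ₑ ^ 2 := by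
  set f : ℝ → ℂ := fun y => ((𝐞 (y * h) : ℂ) - 1) * (k y : ℂ)
  have hb : ∀ y, ‖f y‖ ≤ 2 * |k y| := by
    intro y
    simp only [f, norm_mul, Complex.norm_real, Real.norm_eq_abs]
    exact mul_le_mul_of_nonneg_right (echar_norm_le_two _) (abs_nonneg _)
  have hf : Integrable f := by
    refine (hk.abs.const_mul 2).mono' ?_ (Filter.Eventually.of_forall hb)
    refine AEStronglyMeasurable.mul ?_ hk.ofReal.1
    exact ((echar_meas.comp (measurable_id.mul_const h)).sub_const 1).aestronglyMeasurable
  have he : ∀ t, Kh k (t + h) - Kh k t = 𝓕 f (-t) := by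
    intro t
    unfold Kh
    rw [Real.fourier_real_eq, ← integral_sub]
    · congr 1; ext y
      simp only [f]
      have e1 : (𝐞 ((t + h) * y) : ℂ) = 𝐞 (t * y) * 𝐞 (y * h) := by
        rw [← Circle.coe_mul, ← AddChar.map_add_eq_mul]; congr 2; ring
      have e2 : -(y * -t) = t * y := by ring
      rw [echar_smul, e1, e2]; ring
    all_goals
      refine hk.abs.mono' ?_ ?_
      · refine AEStronglyMeasurable.mul ?_ hk.ofReal.1
        exact (echar_meas.comp (by fun_prop)).aestronglyMeasurable
      · filter_upwards with y
        simp [echar_norm1]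
  simp_rw [he]
  rw [lint_neg (fun t => ‖𝓕 f t‖ₑ ^ 2), ← plancherel f hf (memLp2_of_bdd f hf (2 * M) (fun t => (hb t).trans (by
    have := hM t; linarith)))]
  simp only [f, enorm_mul, mul_pow]
  simp [← ofReal_norm]

end part3

section part4
open scoped RealInnerProductSpace FourierTransform

def gh (g : ℝ → ℝ) (ξ : ℝ) : ENNReal := ‖𝓕 (fun b => (g b : ℂ)) ξ‖ₑ ^ 2

theorem cx_enorm (x : ℝ) : ‖(x : ℂ)‖ₑ = ‖x‖ₑ := by
  simp [← ofReal_norm]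

theorem four_cont (g : ℝ → ℝ) (hg : Integrable g) : Continuous (𝓕 (fun y => (g y : ℂ))) :=
    VectorFourier.fourierIntegral_continuous Real.continuous_fourierChar
      (by exact (innerSL ℝ).continuous₂) hg.ofReal

theorem gh_meas (g : ℝ → ℝ) (hg : Integrable g) : Measurable (gh g) := by
  unfold gh
  exact ((four_cont g hg).measurable.enorm).pow_const 2

structure Nice (g : ℝ → ℝ) : Prop where
  meas : Measurable g
  int : Integrable g
  bdd : ∃ M, ∀ t, |g t| ≤ M

theorem gh_lint (g : ℝ → ℝ) (hg : Nice g) : ∫⁻ ξ, gh g ξ = ∫⁻ x, ‖g x‖ₑ ^ 2 := by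
  obtain ⟨M, hM⟩ := hg.bdd
  unfold gh
  rw [← plancherel (fun y => (g y : ℂ)) (ofReal_intg hg.int)
    (memLp2_of_bdd _ (ofReal_intg hg.int) M (by simpa using hM))]
  simp_rw [cx_enorm]

theorem four_conv (f : ℝ → ℂ) (hf : Integrable f) (ξ : ℝ) : Integrable (fun b => 𝐞 (-(b * ξ)) • f b) := by
  refine hf.norm.mono' ?_ ?_
  · simp only [echar_smul]
    refine AEStronglyMeasurable.mul ?_ hf.1
    exact (echar_meas.comp (by fun_prop)).aestronglyMeasurable
  · filter_upwards with p
    rw [echar_smul, norm_mul, echar_norm1, one_mul]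

theorem formA (k g : ℝ → ℝ) (hk : Nice k) (hg : Nice g) (a a' c c' : ℝ) :
    ∫⁻ b, ‖c * Tf k g a b - c' * Tf k g a' b‖ₑ ^ 2 =
      ∫⁻ ξ, ‖(c : ℂ) * Kh k (a * ξ) - (c' : ℂ) * Kh k (a' * ξ)‖ₑ ^ 2 * gh g ξ := by
  obtain ⟨M, hM⟩ := hg.bdd
  have i1 := ofReal_intg (Tf_int k g hk.int hk.meas hg.meas hg.int a)
  have i2 := ofReal_intg (Tf_int k g hk.int hk.meas hg.meas hg.int a')
  set f : ℝ → ℂ := fun b => (c : ℂ) * (Tf k g a b : ℂ) - (c' : ℂ) * (Tf k g a' b : ℂ) with hf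
  have hfi : Integrable f := (i1.const_mul _).sub (i2.const_mul _)
  set B := M * ∫ y, |k y|
  have hb : ∀ b, ‖f b‖ ≤ |c| * B + |c'| * B := by
    intro b
    refine (norm_sub_le _ _).trans ?_
    simp only [norm_mul, Complex.norm_real, Real.norm_eq_abs]
    gcongr <;> exact Tf_bdd k g hk.int M hM _ _
  have := plancherel f hfi (memLp2_of_bdd f hfi _ hb)
  have e1 : ∀ b, ‖c * Tf k g a b - c' * Tf k g a' b‖ₑ ^ 2 = ‖f b‖ₑ ^ 2 := by
    intro b
    rw [← cx_enorm]; simp only [hf]; push_cast; rfl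
  simp_rw [e1]
  rw [this]
  congr 1; ext ξ
  unfold gh
  rw [← mul_pow, ← enorm_mul]
  congr 2
  have : 𝓕 f ξ = (c : ℂ) * 𝓕 (fun b => (Tf k g a b : ℂ)) ξ - (c' : ℂ) * 𝓕 (fun b => (Tf k g a' b : ℂ)) ξ := by
    simp only [Real.fourier_real_eq]
    rw [← integral_const_mul, ← integral_const_mul, ← integral_sub]
    · congr 1; ext b
      simp only [hf, echar_smul, smul_eq_mul]; ring
    · exact (four_conv _ i1 ξ).const_mul _
    · exact (four_conv _ i2 ξ).const_mul _
  rw [this, Tf_fourier k g hk.int hk.meas hg.meas hg.int, Tf_fourier k g hk.int hk.meas hg.meas hg.int]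
  ring

theorem formB (k g : ℝ → ℝ) (hk : Nice k) (hg : Nice g) (a h : ℝ) :
    ∫⁻ b, ‖Tf k g a b - Tf k g a (b + h)‖ₑ ^ 2 =
      ∫⁻ ξ, ‖(𝐞 (ξ * h) : ℂ) - 1‖ₑ ^ 2 * ‖Kh k (a * ξ)‖ₑ ^ 2 * gh g ξ := by
  obtain ⟨M, hM⟩ := hg.bdd
  have i1 := ofReal_intg (Tf_int k g hk.int hk.meas hg.meas hg.int a)
  have i2 := i1.comp_add_right h
  set f : ℝ → ℂ := fun b => (Tf k g a b : ℂ) - (Tf k g a (b + h) : ℂ) with hf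
  have hfi : Integrable f := i1.sub i2
  set B := M * ∫ y, |k y|
  have hb : ∀ b, ‖f b‖ ≤ B + B := by
    intro b
    refine (norm_sub_le _ _).trans ?_
    simp only [Complex.norm_real, Real.norm_eq_abs]
    gcongr <;> exact Tf_bdd k g hk.int M hM _ _
  have := plancherel f hfi (memLp2_of_bdd f hfi _ hb)
  have e1 : ∀ b, ‖Tf k g a b - Tf k g a (b + h)‖ₑ ^ 2 = ‖f b‖ₑ ^ 2 := by
    intro b
    rw [← cx_enorm]; simp only [hf]; push_cast; rfl
  simp_rw [e1]
  rw [this]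
  congr 1; ext ξ
  unfold gh
  rw [← mul_pow, ← enorm_mul, ← mul_pow, ← enorm_mul]
  have c2 : 𝓕 (fun b => (Tf k g a (b + h) : ℂ)) ξ = 𝐞 (ξ * h) * 𝓕 (fun b => (Tf k g a b : ℂ)) ξ := by
    simp only [Real.fourier_real_eq]
    rw [← integral_const_mul, ← integral_add_right_eq_self (fun x => (𝐞 (ξ * h) : ℂ) * (𝐞 (-(x * ξ)) • (Tf k g a x : ℂ))) h]
    congr 1; ext b
    have : (𝐞 (-(b * ξ)) : ℂ) = 𝐞 (ξ * h) * 𝐞 (-((b + h) * ξ)) := by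
      rw [← Circle.coe_mul, ← AddChar.map_add_eq_mul]; congr 2; ring
    rw [echar_smul, echar_smul, this, mul_assoc]
  have : 𝓕 f ξ = 𝓕 (fun b => (Tf k g a b : ℂ)) ξ - 𝓕 (fun b => (Tf k g a (b + h) : ℂ)) ξ := by
    simp only [Real.fourier_real_eq]
    rw [← integral_sub]
    · congr 1; ext b
      simp only [hf, echar_smul]; ring
    · exact four_conv _ i1 ξ
    · exact four_conv _ i2 ξ
  rw [this, c2, Tf_fourier k g hk.int hk.meas hg.meas hg.int]
  rw [← enorm_neg]
  congr 2
  ring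

end part4

section part5
open scoped RealInnerProductSpace FourierTransform

def Gag1 (m : ℝ → ℝ) : ENNReal := ∫⁻ a, ∫⁻ a', ‖m a - m a'‖ₑ ^ 2 / ‖a - a'‖ₑ ^ 2

theorem Kh_meas (k : ℝ → ℝ) (hk : Integrable k) : Measurable (Kh k) := (Kh_cont k hk).measurable

theorem Kh_leE (k : ℝ → ℝ) (t : ℝ) : ‖Kh k t‖ₑ ≤ ENNReal.ofReal (∫ y, |k y|) := by
  rw [← ofReal_norm]; exact ENNReal.ofReal_le_ofReal (Kh_le k t)

theorem e_meas' {α : Type*} [MeasurableSpace α] {f : α → ℝ} (hf : Measurable f) :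
    Measurable (fun x => ‖(𝐞 (f x) : ℂ) - 1‖ₑ ^ 2) :=
  (((echar_meas.comp hf).sub_const 1).enorm).pow_const 2
theorem Kh_meas' {k : ℝ → ℝ} (hk : Nice k) {α : Type*} [MeasurableSpace α] {f : α → ℝ} (hf : Measurable f) :
    Measurable (fun x => ‖Kh k (f x)‖ₑ ^ 2) :=
  (((Kh_meas k hk.int).comp hf).enorm).pow_const 2
theorem gh_meas' {k : ℝ → ℝ} (hk : Nice k) {α : Type*} [MeasurableSpace α] {f : α → ℝ} (hf : Measurable f) :
    Measurable (fun x => gh k (f x)) :=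
  (gh_meas k hk.int).comp hf

/-- L2 bound -/
theorem L2_nice (m k g : ℝ → ℝ) (hk : Nice k) (hg : Nice g) :
    ∫⁻ a, ∫⁻ b, ‖Wf m k g a b‖ₑ ^ 2 ≤
      (∫⁻ a, ‖m a‖ₑ ^ 2) * ENNReal.ofReal (∫ y, |k y|) ^ 2 * ∫⁻ x, ‖g x‖ₑ ^ 2 := by
  set K := ENNReal.ofReal (∫ y, |k y|)
  calc _ ≤ ∫⁻ a, ‖m a‖ₑ ^ 2 * (K ^ 2 * ∫⁻ x, ‖g x‖ₑ ^ 2) := by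
        apply lintegral_mono; intro a
        have h := formA k g hk hg a a 1 0
        simp only [one_mul, zero_mul, sub_zero, Complex.ofReal_one, Complex.ofReal_zero] at h
        simp only [Wf, enorm_mul, mul_pow]
        rw [lintegral_const_mul' _ _ (by simp), h]
        gcongr
        rw [← gh_lint g hg, ← lintegral_const_mul' _ _ (by simp [K])]
        apply lintegral_mono; intro ξ
        dsimp only
        gcongr
        exact Kh_leE k _
    _ = _ := by rw [lintegral_mul_const' _ _ ?_, mul_assoc]
                · obtain ⟨M, hM⟩ := hg.bdd
                  rw [← gh_lint g hg]
                  refine ENNReal.mul_ne_top (by simp [K]) ?_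
                  rw [gh_lint g hg]
                  have := memLp2_of_bdd _ (ofReal_intg hg.int) M (by simpa using hM)
                  have := (memLp_two_iff_integrable_sq_norm this.1).1 this
                  have := this.2
                  rw [hasFiniteIntegral_iff_enorm] at this
                  convert this.ne using 3 with x
                  rw [enorm_pow, enorm_norm, cx_enorm]

theorem BG_nice (m k g : ℝ → ℝ) (M : ENNReal) (hM : ∀ a, ‖m a‖ₑ ^ 2 ≤ M) (hm : Measurable m) (hk : Nice k) (hg : Nice g) :
    BG (Wf m k g) ≤ M * Dint * (∫⁻ x, ‖k x‖ₑ ^ 2) * ∫⁻ x, ‖g x‖ₑ ^ 2 := by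
  obtain ⟨N, hN⟩ := hk.bdd
  have hKm := Kh_meas k hk.int
  have hgm := gh_meas g hg.int
  have hW := Wf_meas m k g hm hk.meas hg.meas
  calc BG (Wf m k g) = ∫⁻ a, ∫⁻ h, ∫⁻ b, ‖Wf m k g a b - Wf m k g a (b + h)‖ₑ ^ 2 / ‖h‖ₑ ^ 2 := by
        unfold BG
        congr 1; ext a
        symm
        rw [lintegral_lintegral_swap]
        · symm; congr 1; ext b
          rw [← lintegral_add_left_eq_self _ b]
          congr 1; ext h
          rw [show b - (b + h) = -h by ring, enorm_neg]
        · refine Measurable.aemeasurable ?_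
          refine Measurable.div ?_ (by fun_prop)
          exact wsq_meas hW measurable_const measurable_snd measurable_const (by fun_prop)
    _ = ∫⁻ a, ∫⁻ h, ∫⁻ ξ, ‖m a‖ₑ ^ 2 * ((‖(𝐞 (ξ * h) : ℂ) - 1‖ₑ ^ 2 / ‖h‖ₑ ^ 2) * (‖Kh k (a * ξ)‖ₑ ^ 2 * gh g ξ)) := by
        congr 1; ext a; congr 1; ext h
        have h := formB k g hk hg a h
        rw [lintegral_const_mul' _ _ (by simp)]
        simp only [Wf, ← mul_sub, enorm_mul, mul_pow, div_eq_mul_inv, mul_assoc]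
        rw [lintegral_const_mul' _ _ (by simp)]
        congr 1
        rw [lintegral_mul_const, h, mul_comm, ← lintegral_const_mul]
        · congr 1; ext ξ; ring
        · exact ((e_meas' (by fun_prop)).fun_mul (Kh_meas' hk (by fun_prop))).fun_mul (gh_meas' hg measurable_id)
        · exact ((w_meas' (Tf_smeas k g hk.meas hg.meas) measurable_const measurable_id).sub
            (w_meas' (Tf_smeas k g hk.meas hg.meas) measurable_const (by fun_prop))).enorm.pow_const 2
    _ = ∫⁻ a, ∫⁻ ξ, ‖m a‖ₑ ^ 2 * (Dint * ‖ξ‖ₑ * (‖Kh k (a * ξ)‖ₑ ^ 2 * gh g ξ)) := by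
        congr 1; ext a
        rw [lintegral_lintegral_swap]
        · congr 1; ext ξ
          rw [lintegral_const_mul' _ _ (by simp), lintegral_mul_const, Dlem]
          exact (e_meas' (by fun_prop)).div (by fun_prop)
        · refine Measurable.aemeasurable ?_
          exact (((e_meas' (by fun_prop)).div (by fun_prop)).mul
            ((Kh_meas' hk (by fun_prop)).fun_mul (gh_meas' hg measurable_snd))).const_mul _
    _ ≤ ∫⁻ a, ∫⁻ ξ, M * (Dint * ‖ξ‖ₑ * (‖Kh k (a * ξ)‖ₑ ^ 2 * gh g ξ)) := by
        gcongr with a ξ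
        exact hM a
    _ = ∫⁻ ξ, ∫⁻ a, M * (Dint * ‖ξ‖ₑ * (‖Kh k (a * ξ)‖ₑ ^ 2 * gh g ξ)) := by
        rw [lintegral_lintegral_swap]
        refine Measurable.aemeasurable ?_
        exact (((measurable_snd.enorm.const_mul _)).mul
            ((Kh_meas' hk (by fun_prop)).fun_mul (gh_meas' hg measurable_snd))).const_mul _
    _ ≤ ∫⁻ ξ, M * Dint * (∫⁻ x, ‖k x‖ₑ ^ 2) * gh g ξ := by
        apply lintegral_mono; intro ξ
        simp only
        rcases eq_or_ne ξ 0 with rfl | hξ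
        · simp
        have h1 := lint_scale (fun t => ‖Kh k t‖ₑ ^ 2) (hKm.enorm.pow_const 2) ξ hξ
        rw [Kh_planch k hk.int N hN] at h1
        have hξ' : ‖ξ‖ₑ ≠ 0 := by simpa using hξ
        simp_rw [mul_comm _ ξ]
        rw [lintegral_const_mul, lintegral_const_mul, lintegral_mul_const, h1]
        · rw [show M * (Dint * ‖ξ‖ₑ * (‖ξ‖ₑ⁻¹ * (∫⁻ x, ‖k x‖ₑ ^ 2) * gh g ξ)) = (‖ξ‖ₑ * ‖ξ‖ₑ⁻¹) * (M * Dint * (∫⁻ x, ‖k x‖ₑ ^ 2) * gh g ξ) by ring,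
            ENNReal.mul_inv_cancel hξ' (by simp), one_mul]
        · exact Kh_meas' hk (by fun_prop)
        · exact (Kh_meas' hk (by fun_prop)).mul_const _
        · exact ((Kh_meas' hk (by fun_prop)).mul_const _).const_mul _
    _ = _ := by rw [lintegral_const_mul _ hgm, gh_lint g hg]

end part5

section part6
open scoped RealInnerProductSpace FourierTransform

theorem sq_splitC (x y z : ℂ) : ‖x - z‖ₑ ^ 2 ≤ 2 * ‖x - y‖ₑ ^ 2 + 2 * ‖y - z‖ₑ^2 := by
  have : x - z = (x - y) + (y - z) := by ring
  rw [this, ensq_eq, ensq_eq, ensq_eq]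
  generalize x - y = u; generalize y - z = v
  rw [show (2:ENNReal) = ENNReal.ofReal 2 by simp, ← ENNReal.ofReal_mul (by norm_num), ← ENNReal.ofReal_mul (by norm_num),
    ← ENNReal.ofReal_add (by positivity) (by positivity)]
  apply ENNReal.ofReal_le_ofReal
  have h1 := norm_add_le u v
  have := norm_nonneg (u+v)
  nlinarith [sq_nonneg (‖u‖ - ‖v‖)]

theorem Kdiff_int (k : ℝ → ℝ) (hk : Nice k) (ξ : ℝ) :
    ∫⁻ a, ∫⁻ a', ‖Kh k (a * ξ) - Kh k (a' * ξ)‖ₑ ^ 2 / ‖a - a'‖ₑ ^ 2 ≤ Dint * ∫⁻ y, ‖y‖ₑ * ‖k y‖ₑ ^ 2 := by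
  obtain ⟨N, hN⟩ := hk.bdd
  have hKm := Kh_meas k hk.int
  rcases eq_or_ne ξ 0 with rfl | hξ
  · simp
  have hξ' : ‖ξ‖ₑ ≠ 0 := by simpa using hξ
  have hdm : ∀ {α : Type} [MeasurableSpace α] {f f' : α → ℝ} (_ : Measurable f) (_ : Measurable f'),
      Measurable (fun x => ‖Kh k (f x) - Kh k (f' x)‖ₑ ^ 2) := fun hf hf' =>
    ((hKm.comp hf).sub (hKm.comp hf')).enorm.pow_const 2
  calc _ = ∫⁻ a, ∫⁻ h, ‖Kh k (a * ξ + h * ξ) - Kh k (a * ξ)‖ₑ ^ 2 / ‖h‖ₑ ^ 2 := by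
        congr 1; ext a
        rw [← lintegral_add_left_eq_self _ a]
        congr 1; ext h
        rw [show a - (a + h) = -h by ring, enorm_neg, ← enorm_neg, neg_sub, add_mul]
    _ = ∫⁻ h, ∫⁻ a, ‖Kh k (ξ * a + h * ξ) - Kh k (ξ * a)‖ₑ ^ 2 / ‖h‖ₑ ^ 2 := by
        rw [lintegral_lintegral_swap]
        · simp_rw [mul_comm ξ]
        · exact ((hdm (by fun_prop) (by fun_prop)).div (by fun_prop)).aemeasurable
    _ = ∫⁻ h, ‖ξ‖ₑ⁻¹ * ∫⁻ y, (‖(𝐞 (y * ξ * h) : ℂ) - 1‖ₑ ^ 2 / ‖h‖ₑ ^ 2) * ‖k y‖ₑ ^ 2 := by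
        congr 1; ext h
        have h1 := lint_scale (fun t => ‖Kh k (t + h * ξ) - Kh k t‖ₑ ^ 2) (hdm (by fun_prop) (by fun_prop)) ξ hξ
        rw [Kh_diff k hk.int N hN] at h1
        simp only [div_eq_mul_inv]
        rw [lintegral_mul_const _ (hdm (by fun_prop) (by fun_prop)), h1, mul_assoc, ← lintegral_mul_const]
        · congr 2; ext y
          rw [show y * (h * ξ) = y * ξ * h by ring]; ring
        · exact (e_meas' (by fun_prop)).fun_mul (hk.meas.enorm.pow_const 2)
    _ = ‖ξ‖ₑ⁻¹ * ∫⁻ y, (Dint * ‖y * ξ‖ₑ) * ‖k y‖ₑ ^ 2 := by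
        rw [lintegral_const_mul' _ _ (by simpa using hξ), lintegral_lintegral_swap]
        · congr 2; ext y
          rw [lintegral_mul_const' _ _ (by simp), Dlem]
        · exact (((e_meas' (by fun_prop)).div (by fun_prop)).mul ((hk.meas.comp measurable_snd).enorm.pow_const 2)).aemeasurable
    _ = _ := by
        have hk2 : Measurable (fun y => ‖y‖ₑ * ‖k y‖ₑ ^ 2) := measurable_enorm.mul (hk.meas.enorm.pow_const 2)
        have : ∀ y, (Dint * ‖y * ξ‖ₑ) * ‖k y‖ₑ ^ 2 = (‖ξ‖ₑ * Dint) * (‖y‖ₑ * ‖k y‖ₑ ^ 2) := by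
          intro y; rw [enorm_mul]; ring
        simp_rw [this]
        rw [lintegral_const_mul _ hk2, ← mul_assoc, ← mul_assoc, ENNReal.inv_mul_cancel hξ' (by simp), one_mul]
    _ ≤ _ := le_rfl

theorem AG_nice (m k g : ℝ → ℝ) (M : ENNReal) (hMt : M ≠ ⊤) (hM : ∀ a, ‖m a‖ₑ ^ 2 ≤ M) (hm : Measurable m) (hk : Nice k) (hg : Nice g) :
    AG (Wf m k g) ≤ (2 * M * (Dint * ∫⁻ y, ‖y‖ₑ * ‖k y‖ₑ ^ 2) + 2 * ENNReal.ofReal (∫ y, |k y|) ^ 2 * Gag1 m) *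
      ∫⁻ x, ‖g x‖ₑ ^ 2 := by
  have hKm := Kh_meas k hk.int
  have hdm : ∀ {α : Type} [MeasurableSpace α] {f f' : α → ℝ} (_ : Measurable f) (_ : Measurable f'),
      Measurable (fun x => ‖Kh k (f x) - Kh k (f' x)‖ₑ ^ 2) := fun hf hf' =>
    ((hKm.comp hf).sub (hKm.comp hf')).enorm.pow_const 2
  have hgm := gh_meas g hg.int
  have hcm : ∀ {α : Type} [MeasurableSpace α] {f f' : α → ℝ} (_ : Measurable f) (_ : Measurable f'),
      Measurable (fun x => ‖m (f x) - m (f' x)‖ₑ ^ 2) := fun hf hf' =>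
    ((hm.comp hf).sub (hm.comp hf')).enorm.pow_const 2
  set K := ENNReal.ofReal (∫ y, |k y|)
  have hsm : Measurable (fun x : ℝ × ℝ × ℝ => (2 * (M * (‖Kh k (x.1 * x.2.2) - Kh k (x.2.1 * x.2.2)‖ₑ ^ 2 / ‖x.1 - x.2.1‖ₑ ^ 2)) +
          2 * (K ^ 2 * (‖m x.1 - m x.2.1‖ₑ ^ 2 / ‖x.1 - x.2.1‖ₑ ^ 2))) * gh g x.2.2) := by
    refine Measurable.mul (Measurable.add ?_ ?_) (gh_meas' hg (by fun_prop))
    · exact ((((hdm (by fun_prop) (by fun_prop)).div (by fun_prop)).const_mul M).const_mul 2)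
    · exact ((((hcm (by fun_prop) (by fun_prop)).div (by fun_prop)).const_mul (K^2)).const_mul 2)
  calc AG (Wf m k g) ≤ ∫⁻ a, ∫⁻ a', ∫⁻ ξ, (2 * (M * (‖Kh k (a * ξ) - Kh k (a' * ξ)‖ₑ ^ 2 / ‖a - a'‖ₑ ^ 2)) +
          2 * (K ^ 2 * (‖m a - m a'‖ₑ ^ 2 / ‖a - a'‖ₑ ^ 2))) * gh g ξ := by
        unfold AG
        apply lintegral_mono; intro a
        apply lintegral_mono; intro a'
        simp only [div_eq_mul_inv]
        rw [lintegral_mul_const]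
        · simp only [Wf]
          rw [formA k g hk hg a a' (m a) (m a'), ← lintegral_mul_const]
          · apply lintegral_mono; intro ξ
            simp only
            calc _ ≤ (2 * (M * ‖Kh k (a * ξ) - Kh k (a' * ξ)‖ₑ ^ 2) + 2 * (K ^ 2 * ‖m a - m a'‖ₑ ^ 2)) * gh g ξ * (‖a - a'‖ₑ ^ 2)⁻¹ := by
                  gcongr
                  refine (sq_splitC _ ((m a : ℂ) * Kh k (a' * ξ)) _).trans ?_
                  rw [← mul_sub, ← sub_mul, enorm_mul, enorm_mul, mul_pow, mul_pow, cx_enorm, ← Complex.ofReal_sub, cx_enorm,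
                    mul_comm (‖m a - m a'‖ₑ ^ 2)]
                  gcongr
                  · exact hM a
                  · exact Kh_leE k _
              _ = _ := by ring
          · refine Measurable.fun_mul ?_ hgm
            exact ((((hKm.comp (by fun_prop)).const_mul _).sub ((hKm.comp (by fun_prop)).const_mul _)).enorm).pow_const 2
        · have hW := Wf_meas m k g hm hk.meas hg.meas
          exact wsq_meas hW measurable_const measurable_id measurable_const measurable_id
    _ = ∫⁻ ξ, ∫⁻ a, ∫⁻ a', (2 * (M * (‖Kh k (a * ξ) - Kh k (a' * ξ)‖ₑ ^ 2 / ‖a - a'‖ₑ ^ 2)) +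
          2 * (K ^ 2 * (‖m a - m a'‖ₑ ^ 2 / ‖a - a'‖ₑ ^ 2))) * gh g ξ := by
        have : ∀ a, ∫⁻ a', ∫⁻ ξ, (2 * (M * (‖Kh k (a * ξ) - Kh k (a' * ξ)‖ₑ ^ 2 / ‖a - a'‖ₑ ^ 2)) +
          2 * (K ^ 2 * (‖m a - m a'‖ₑ ^ 2 / ‖a - a'‖ₑ ^ 2))) * gh g ξ = ∫⁻ ξ, ∫⁻ a', (2 * (M * (‖Kh k (a * ξ) - Kh k (a' * ξ)‖ₑ ^ 2 / ‖a - a'‖ₑ ^ 2)) +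
          2 * (K ^ 2 * (‖m a - m a'‖ₑ ^ 2 / ‖a - a'‖ₑ ^ 2))) * gh g ξ := by
          intro a
          rw [lintegral_lintegral_swap]
          exact (hsm.comp (f := fun p : ℝ × ℝ => (a, p.1, p.2)) (by fun_prop)).aemeasurable
        simp_rw [this]
        rw [lintegral_lintegral_swap]
        refine Measurable.aemeasurable ?_
        have := hsm.comp (f := fun p : (ℝ × ℝ) × ℝ => (p.1.1, p.2, p.1.2)) (by fun_prop)
        exact this.lintegral_prod_right'
    _ ≤ ∫⁻ ξ, (2 * M * (Dint * ∫⁻ y, ‖y‖ₑ * ‖k y‖ₑ ^ 2) + 2 * K ^ 2 * Gag1 m) * gh g ξ := by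
        apply lintegral_mono; intro ξ
        dsimp only
        have hgt : gh g ξ ≠ ⊤ := by unfold gh; simp
        simp_rw [lintegral_mul_const' _ _ hgt]
        gcongr
        have : ∀ a, ∫⁻ a', (2 * (M * (‖Kh k (a * ξ) - Kh k (a' * ξ)‖ₑ ^ 2 / ‖a - a'‖ₑ ^ 2)) +
          2 * (K ^ 2 * (‖m a - m a'‖ₑ ^ 2 / ‖a - a'‖ₑ ^ 2))) = 2 * (M * ∫⁻ a', (‖Kh k (a * ξ) - Kh k (a' * ξ)‖ₑ ^ 2 / ‖a - a'‖ₑ ^ 2)) +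
          2 * (K ^ 2 * ∫⁻ a', (‖m a - m a'‖ₑ ^ 2 / ‖a - a'‖ₑ ^ 2)) := by
          intro a
          rw [lintegral_add_left, lintegral_const_mul' _ _ (by simp), lintegral_const_mul' _ _ hMt, lintegral_const_mul' _ _ (by simp), lintegral_const_mul' _ _ (by simp [K])]
          exact (((hdm (by fun_prop) (by fun_prop)).div (by fun_prop)).const_mul M).const_mul 2
        simp_rw [this]
        rw [lintegral_add_left, lintegral_const_mul' _ _ (by simp), lintegral_const_mul' _ _ hMt, lintegral_const_mul' _ _ (by simp), lintegral_const_mul' _ _ (by simp [K]), mul_assoc, mul_assoc]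
        · gcongr
          · exact Kdiff_int k hk ξ
          · exact le_rfl
        · refine ((Measurable.const_mul ?_ M).const_mul 2)
          exact ((hdm (f := fun p : ℝ × ℝ => p.1 * ξ) (f' := fun p => p.2 * ξ) (by fun_prop) (by fun_prop)).div (by fun_prop) : Measurable (fun p : ℝ × ℝ => ‖Kh k (p.1 * ξ) - Kh k (p.2 * ξ)‖ₑ ^ 2 / ‖p.1 - p.2‖ₑ ^ 2)).lintegral_prod_right'
    _ = _ := by rw [lintegral_const_mul _ hgm, gh_lint g hg]

end part6

section part7
open scoped RealInnerProductSpace FourierTransform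

theorem scale_memLp (g : ℝ → ℝ) (hgm : Measurable g) (hg : MemLp g 2) (a b : ℝ) (ha : a ≠ 0) :
    MemLp (fun y => g (b + a * y)) 2 := by
  refine (memLp_two_iff_integrable_sq (hgm.comp (f := fun y => b + a * y) (by fun_prop)).aestronglyMeasurable).2 ?_
  have h := (memLp_two_iff_integrable_sq hgm.aestronglyMeasurable).1 hg
  exact ((h.comp_add_left b).comp_mul_left' ha)

theorem nice_memLp {k : ℝ → ℝ} (hk : Nice k) : MemLp k 2 := by
  obtain ⟨M, hM⟩ := hk.bdd
  rw [memLp_two_iff_integrable_sq hk.int.1]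
  refine (hk.int.norm.const_mul M).mono' (hk.int.1.pow 2) ?_
  filter_upwards with t
  rw [Real.norm_eq_abs, abs_of_nonneg (by positivity), ← sq_abs, sq]
  exact mul_le_mul_of_nonneg_right (hM t) (abs_nonneg _)

theorem Tf_integrand (k g : ℝ → ℝ) (hk : Nice k) (hgm : Measurable g) (hg : MemLp g 2) (a b : ℝ) :
    Integrable (fun y => g (b + a * y) * k y) := by
  rcases eq_or_ne a 0 with rfl | ha
  · simp only [zero_mul, add_zero]; exact hk.int.const_mul _
  · exact (scale_memLp g hgm hg a b ha).integrable_mul (nice_memLp hk)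

def trn (g : ℝ → ℝ) (n : ℕ) : ℝ → ℝ := indicator {t | |t| ≤ n ∧ |g t| ≤ n} g

theorem trn_meas (g : ℝ → ℝ) (hgm : Measurable g) (n : ℕ) : Measurable (trn g n) := by
  refine hgm.indicator ?_
  exact (measurableSet_le (measurable_id.abs) measurable_const).inter (measurableSet_le hgm.abs measurable_const)

theorem trn_le (g : ℝ → ℝ) (n : ℕ) (t : ℝ) : |trn g n t| ≤ |g t| := by
  unfold trn; unfold indicator; split_ifs <;> simp

theorem trn_nice (g : ℝ → ℝ) (hgm : Measurable g) (n : ℕ) : Nice (trn g n) := by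
  have hb : ∀ t, |trn g n t| ≤ n := by
    intro t; unfold trn indicator; split_ifs with h
    · exact h.2
    · simp
  refine ⟨trn_meas g hgm n, ?_, n, hb⟩
  have : Integrable (indicator (Icc (-(n:ℝ)) n) (fun _ => (n:ℝ))) :=
    (integrable_indicator_iff measurableSet_Icc).2 (by simp)
  refine this.mono' (trn_meas g hgm n).aestronglyMeasurable ?_
  filter_upwards with t
  by_cases ht : t ∈ Icc (-(n:ℝ)) n
  · rw [indicator_of_mem ht]; exact hb t
  · rw [indicator_of_notMem ht]
    have : trn g n t = 0 := by
      unfold trn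
      rw [indicator_of_notMem]
      rintro ⟨h, -⟩
      exact ht (abs_le.1 h)
    simp [this]

theorem trn_tendsto (g : ℝ → ℝ) (t : ℝ) : Filter.Tendsto (fun n => trn g n t) Filter.atTop (nhds (g t)) := by
  refine tendsto_const_nhds.congr' ?_
  obtain ⟨N, hN⟩ := exists_nat_ge (max |t| |g t|)
  filter_upwards [Filter.eventually_ge_atTop N] with n hn
  have hn' : (N:ℝ) ≤ n := by exact_mod_cast hn
  unfold trn
  rw [indicator_of_mem]
  exact ⟨(le_max_left _ _).trans (hN.trans hn'), (le_max_right _ _).trans (hN.trans hn')⟩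

theorem Wf_tendsto (m k g : ℝ → ℝ) (hk : Nice k) (hgm : Measurable g) (hg : MemLp g 2) (a b : ℝ) :
    Filter.Tendsto (fun n => Wf m k (trn g n) a b) Filter.atTop (nhds (Wf m k g a b)) := by
  unfold Wf Tf
  refine Filter.Tendsto.const_mul _ ?_
  refine tendsto_integral_of_dominated_convergence (fun y => |g (b + a * y) * k y|) ?_ ?_ ?_ ?_
  · intro n
    exact (((trn_meas g hgm n).comp (by fun_prop)).mul hk.meas).aestronglyMeasurable
  · exact (Tf_integrand k g hk hgm hg a b).abs
  · intro n
    filter_upwards with y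
    rw [Real.norm_eq_abs, abs_mul, abs_mul]
    exact mul_le_mul_of_nonneg_right (trn_le _ _ _) (abs_nonneg _)
  · filter_upwards with y
    exact (trn_tendsto g _).mul_const _

theorem trn_L2 (g : ℝ → ℝ) (n : ℕ) : ∫⁻ x, ‖trn g n x‖ₑ ^ 2 ≤ ∫⁻ x, ‖g x‖ₑ ^ 2 := by
  gcongr with x
  rw [← ofReal_norm, ← ofReal_norm]
  exact ENNReal.ofReal_le_ofReal (trn_le g n x)

structure OKm (m : ℝ → ℝ) : Prop where
  meas : Measurable m
  bdd : ∃ M, ∀ t, |m t| ≤ M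
  l2 : ∫⁻ a, ‖m a‖ₑ ^ 2 < ⊤
  gag : Gag1 m < ⊤

structure OKk (k : ℝ → ℝ) : Prop where
  nice : Nice k
  mom : ∫⁻ y, ‖y‖ₑ * ‖k y‖ₑ ^ 2 < ⊤

theorem memLp_lint {α : Type*} [MeasurableSpace α] {μ : Measure α} {g : α → ℝ} (hg : MemLp g 2 μ) : ∫⁻ x, ‖g x‖ₑ ^ 2 ∂μ < ⊤ := by
  have := ((memLp_two_iff_integrable_sq hg.1).1 hg).2
  rw [hasFiniteIntegral_iff_enorm] at this
  simpa [enorm_pow] using this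

theorem NG_nice (m k : ℝ → ℝ) (hm : OKm m) (hk : OKk k) :
    ∃ C : ENNReal, C < ⊤ ∧ ∀ g, Nice g → NG (Wf m k g) ≤ C * ∫⁻ x, ‖g x‖ₑ ^ 2 := by
  obtain ⟨M, hM⟩ := hm.bdd
  have hM' : ∀ a, ‖m a‖ₑ ^ 2 ≤ ENNReal.ofReal (M ^ 2) := by
    intro a
    rw [ensq_eqR, ← sq_abs]
    exact ENNReal.ofReal_le_ofReal (pow_le_pow_left₀ (abs_nonneg _) (hM a) 2)
  have hk2 := memLp_lint (nice_memLp hk.nice)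
  refine ⟨2 * ENNReal.ofReal π * ((2 * ENNReal.ofReal (M ^ 2) * (Dint * ∫⁻ y, ‖y‖ₑ * ‖k y‖ₑ ^ 2) + 2 * ENNReal.ofReal (∫ y, |k y|) ^ 2 * Gag1 m)
    + ENNReal.ofReal (M ^ 2) * Dint * (∫⁻ x, ‖k x‖ₑ ^ 2)), ?_, ?_⟩
  · have := Dint_lt; have := hm.gag; have := hk.mom
    finiteness
  · intro g hg
    refine (NG_le _ (Wf_meas m k g hm.meas hk.nice.meas hg.meas)).trans ?_
    rw [mul_assoc _ _ (∫⁻ x, ‖g x‖ₑ ^ 2), add_mul]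
    gcongr
    · exact AG_nice m k g _ (by simp) hM' hm.meas hk.nice hg
    · exact BG_nice m k g _ hM' hm.meas hk.nice hg

theorem NGint_meas (w : ℝ → ℝ → ℝ) (hw : Measurable (Function.uncurry w)) :
    Measurable (fun x : (ℝ × ℝ) × (ℝ × ℝ) => ‖w x.1.1 x.1.2 - w x.2.1 x.2.2‖ₑ ^ 2 * kap (x.1.1 - x.2.1) (x.1.2 - x.2.2)) := by
  apply Measurable.fun_mul
  · exact wsq_meas hw (by fun_prop) (by fun_prop) (by fun_prop) (by fun_prop)
  · exact kap_meas' (by fun_prop) (by fun_prop)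

theorem NG_prod (w : ℝ → ℝ → ℝ) (hw : Measurable (Function.uncurry w)) :
    NG w = ∫⁻ x : (ℝ × ℝ) × (ℝ × ℝ), ‖w x.1.1 x.1.2 - w x.2.1 x.2.2‖ₑ ^ 2 * kap (x.1.1 - x.2.1) (x.1.2 - x.2.2) := by
  unfold NG
  rw [Measure.volume_eq_prod (ℝ × ℝ) (ℝ × ℝ), lintegral_prod _ (NGint_meas w hw).aemeasurable]

theorem NG_gen (m k g : ℝ → ℝ) (hm : OKm m) (hk : OKk k) (hgm : Measurable g) (hg : MemLp g 2) :
    NG (Wf m k g) < ⊤ := by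
  obtain ⟨C, hC, hCb⟩ := NG_nice m k hm hk
  refine lt_of_le_of_lt ?_ (ENNReal.mul_lt_top hC (memLp_lint hg))
  rw [NG_prod _ (Wf_meas m k g hm.meas hk.nice.meas hgm)]
  have hlim : ∀ x : (ℝ × ℝ) × (ℝ × ℝ), ‖Wf m k g x.1.1 x.1.2 - Wf m k g x.2.1 x.2.2‖ₑ ^ 2 * kap (x.1.1 - x.2.1) (x.1.2 - x.2.2) =
      Filter.liminf (fun n => ‖Wf m k (trn g n) x.1.1 x.1.2 - Wf m k (trn g n) x.2.1 x.2.2‖ₑ ^ 2 * kap (x.1.1 - x.2.1) (x.1.2 - x.2.2)) Filter.atTop := by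
    intro x
    symm
    apply Filter.Tendsto.liminf_eq
    refine ENNReal.Tendsto.mul_const ?_ (Or.inr (by simp [kap]))
    refine ((ENNReal.continuous_pow 2).tendsto _).comp ?_
    exact (continuous_enorm.tendsto _).comp ((Wf_tendsto m k g hk.nice hgm hg _ _).sub (Wf_tendsto m k g hk.nice hgm hg _ _))
  simp_rw [hlim]
  refine (lintegral_liminf_le (fun n => NGint_meas _ (Wf_meas m k (trn g n) hm.meas hk.nice.meas (trn_meas g hgm n)))).trans ?_
  refine Filter.liminf_le_of_le (by isBoundedDefault) ?_
  intro b hb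
  obtain ⟨n, hn⟩ := hb.exists
  refine hn.trans ?_
  rw [← NG_prod _ (Wf_meas m k (trn g n) hm.meas hk.nice.meas (trn_meas g hgm n))]
  refine (hCb _ (trn_nice g hgm n)).trans ?_
  exact mul_le_mul_right (trn_L2 g n) _

theorem L2_gen (m k g : ℝ → ℝ) (hm : OKm m) (hk : OKk k) (hgm : Measurable g) (hg : MemLp g 2) :
    ∫⁻ x : ℝ × ℝ, ‖Wf m k g x.1 x.2‖ₑ ^ 2 < ⊤ := by
  have hfin : (∫⁻ a, ‖m a‖ₑ ^ 2) * ENNReal.ofReal (∫ y, |k y|) ^ 2 * ∫⁻ x, ‖g x‖ₑ ^ 2 < ⊤ := by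
    have := hm.l2; have := memLp_lint hg
    finiteness
  refine lt_of_le_of_lt ?_ hfin
  have hms : ∀ g, Measurable g → Measurable (fun x : ℝ × ℝ => ‖Wf m k g x.1 x.2‖ₑ ^ 2) := fun g hg =>
    (w_meas' (Wf_meas m k g hm.meas hk.nice.meas hg) measurable_fst measurable_snd).enorm.pow_const 2
  have hlim : ∀ x : ℝ × ℝ, ‖Wf m k g x.1 x.2‖ₑ ^ 2 =
      Filter.liminf (fun n => ‖Wf m k (trn g n) x.1 x.2‖ₑ ^ 2) Filter.atTop := by
    intro x
    symm
    apply Filter.Tendsto.liminf_eq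
    refine ((ENNReal.continuous_pow 2).tendsto _).comp ?_
    exact (continuous_enorm.tendsto _).comp (Wf_tendsto m k g hk.nice hgm hg _ _)
  simp_rw [hlim]
  refine (lintegral_liminf_le (fun n => hms _ (trn_meas g hgm n))).trans ?_
  refine Filter.liminf_le_of_le (by isBoundedDefault) ?_
  intro b hb
  obtain ⟨n, hn⟩ := hb.exists
  refine hn.trans ?_
  rw [Measure.volume_eq_prod ℝ ℝ, lintegral_prod _ (hms _ (trn_meas g hgm n)).aemeasurable]
  refine (L2_nice m k _ hk.nice (trn_nice g hgm n)).trans ?_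
  exact mul_le_mul_right (trn_L2 g n) _

end part7

section part8
open scoped RealInnerProductSpace FourierTransform

structure Cc (k : ℝ → ℝ) : Prop where
  smooth : ContDiff ℝ (⊤ : ℕ∞) k
  supp : HasCompactSupport k

theorem Cc.bdd {k : ℝ → ℝ} (hk : Cc k) : ∃ M, ∀ t, |k t| ≤ M := by
  obtain ⟨C, hC⟩ := hk.smooth.continuous.bounded_above_of_compact_support hk.supp
  exact ⟨C, hC⟩

theorem Cc.supp_Icc {k : ℝ → ℝ} (hk : Cc k) : ∃ R > 0, ∀ t, R < |t| → k t = 0 := by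
  obtain ⟨R, hR⟩ := hk.supp.isCompact.isBounded.subset_closedBall 0
  refine ⟨max R 1, by positivity, fun t ht => ?_⟩
  by_contra h
  have := hR (subset_tsupport k h)
  simp at this
  have := le_max_left R 1
  linarith

theorem Cc.nice {k : ℝ → ℝ} (hk : Cc k) : Nice k :=
  ⟨hk.smooth.continuous.measurable, hk.smooth.continuous.integrable_of_hasCompactSupport hk.supp, hk.bdd⟩

theorem Cc.okk {k : ℝ → ℝ} (hk : Cc k) : OKk k := by
  refine ⟨hk.nice, ?_⟩
  have : HasCompactSupport (fun y => y * k y ^ 2) := by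
    have : (fun y => y * k y ^ 2) = (fun y => y * k y) * k := by ext y; simp; ring
    rw [this]; exact hk.supp.mul_left
  have hc := hk.smooth.continuous
  have := (Continuous.integrable_of_hasCompactSupport (μ := (volume : Measure ℝ)) (by fun_prop) this).2
  rw [hasFiniteIntegral_iff_enorm] at this
  simpa [enorm_mul, enorm_pow] using this

theorem gag_fin (m : ℝ → ℝ) (hm : Cc m) : Gag1 m < ⊤ := by
  obtain ⟨M, hM⟩ := hm.bdd
  obtain ⟨R, hR, hsup⟩ := hm.supp_Icc
  obtain ⟨L, hL⟩ := (hm.smooth).lipschitzWith_of_hasCompactSupport hm.supp (by simp)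
  set C : ℝ := L ^ 2 + 4 * M ^ 2
  set ind : ℝ → ENNReal := indicator (Icc (-R) R) 1
  have hind : Measurable ind := measurable_one.indicator measurableSet_Icc
  set P : ℝ → ENNReal := fun h => ENNReal.ofReal C * ENNReal.ofReal ((1 + h^2)⁻¹)
  have hP : Measurable P := by unfold P; fun_prop
  have hPf : ∫⁻ h, P h < ⊤ := by
    unfold P; rw [lintegral_const_mul' _ _ (by simp), inv_one_add_sq_lint]
    finiteness
  have hif : ∫⁻ a, ind a < ⊤ := by
    unfold ind; rw [lintegral_indicator_one measurableSet_Icc]; simp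
  have key : ∀ a h, ‖m a - m (a + h)‖ₑ ^ 2 / ‖a - (a + h)‖ₑ ^ 2 ≤ P h * ind a + P h * ind (a + h) := by
    intro a h
    rw [← mul_add]
    by_cases h0 : a ∈ Icc (-R) R ∨ a + h ∈ Icc (-R) R
    · have h1 : 1 ≤ ind a + ind (a + h) := by
        rcases h0 with h0 | h0
        · simp [ind, h0]
        · simp [ind, h0]
      refine le_trans ?_ (le_mul_of_one_le_right (by simp) h1)
      rcases eq_or_ne h 0 with rfl | hh
      · simp
      rw [show a - (a + h) = -h by ring, enorm_neg, ensq_eqR, ensq_eqR, ← ENNReal.ofReal_div_of_pos (by positivity)]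
      unfold P
      rw [← ENNReal.ofReal_mul (by positivity)]
      apply ENNReal.ofReal_le_ofReal
      rw [← div_eq_mul_inv, div_le_div_iff₀ (by positivity) (by positivity)]
      have e1 : |m a - m (a + h)| ≤ L * |h| := by
        have := hL.dist_le_mul a (a + h)
        simpa [Real.dist_eq, abs_neg] using this
      have e2 : |m a - m (a + h)| ≤ 2 * M := by
        have := abs_sub (m a) (m (a + h)); have := hM a; have := hM (a + h); linarith
      have f1 : (m a - m (a + h)) ^ 2 ≤ L ^ 2 * h ^ 2 := by
        rw [← sq_abs, ← sq_abs h, ← mul_pow]; exact pow_le_pow_left₀ (abs_nonneg _) e1 2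
      have f2 : (m a - m (a + h)) ^ 2 ≤ 4 * M ^ 2 := by
        rw [← sq_abs]; have := pow_le_pow_left₀ (abs_nonneg _) e2 2; linarith
      have f3 := mul_le_mul_of_nonneg_right f2 (sq_nonneg h)
      unfold C
      linarith
    · push Not at h0
      have z : ∀ t, t ∉ Icc (-R) R → m t = 0 := by
        intro t ht; apply hsup; by_contra hh; exact ht (abs_le.1 (not_lt.1 hh))
      simp [z _ h0.1, z _ h0.2]
  have s1 : Gag1 m ≤ ∫⁻ a, ∫⁻ h, (P h * ind a + P h * ind (a + h)) := by
    unfold Gag1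
    apply lintegral_mono; intro a
    dsimp only
    rw [← lintegral_add_left_eq_self _ a]
    apply lintegral_mono; intro h
    exact key a h
  refine lt_of_le_of_lt s1 ?_
  have s2 : ∀ a, ∫⁻ h, (P h * ind a + P h * ind (a + h)) = (∫⁻ h, P h) * ind a + ∫⁻ h, P h * ind (a + h) := by
    intro a
    rw [lintegral_add_left (hP.mul_const _), lintegral_mul_const _ hP]
  simp_rw [s2]
  rw [lintegral_add_left (hind.const_mul _), lintegral_const_mul _ hind, lintegral_lintegral_swap]
  · have : ∀ y, ∫⁻ x, P y * ind (x + y) = P y * ∫⁻ x, ind x := by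
      intro y
      rw [lintegral_const_mul' _ _ (by simp [P, ENNReal.mul_eq_top]), lintegral_add_right_eq_self]
    simp_rw [this]
    rw [lintegral_mul_const _ hP]
    finiteness
  · exact ((hP.comp measurable_snd).mul (hind.comp (by fun_prop))).aemeasurable

theorem Cc.okm {k : ℝ → ℝ} (hk : Cc k) : OKm k :=
  ⟨hk.nice.meas, hk.bdd, memLp_lint (nice_memLp hk.nice), gag_fin k hk⟩

/-! transfer -/
def Good (u : E2 → ℝ) : Prop := L2on quadrant u ∧ GagH12 quadrant u

theorem mp_pair (i j : Fin 2) (hij : i ≠ j) : MeasurePreserving (fun x : E2 => (x i, x j)) volume volume := by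
  have h := (volume_preserving_finTwoArrow ℝ).comp (EuclideanSpace.volume_preserving_symm_measurableEquiv_toLp (Fin 2))
  have h01 : MeasurePreserving (fun x : E2 => (x 0, x 1)) volume volume := h
  fin_cases i <;> fin_cases j <;> simp at hij ⊢
  · exact h01
  · exact (Measure.measurePreserving_swap (μ := (volume : Measure ℝ)) (ν := (volume : Measure ℝ))).comp h01

theorem norm_E2 (x : E2) (i j : Fin 2) (hij : i ≠ j) : ‖x‖ = √(x i ^ 2 + x j ^ 2) := by
  rw [EuclideanSpace.norm_eq]
  fin_cases i <;> fin_cases j <;> simp at hij ⊢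
  rw [add_comm]

theorem good_of (w : ℝ → ℝ → ℝ) (hw : Measurable (Function.uncurry w)) (hN : NG w < ⊤)
    (hL : ∫⁻ x : ℝ × ℝ, ‖w x.1 x.2‖ₑ ^ 2 < ⊤) (i j : Fin 2) (hij : i ≠ j) :
    Good (fun x => w (x i) (x j)) := by
  have mp := mp_pair i j hij
  have hwm : Measurable (fun x : E2 => w (x i) (x j)) := hw.comp mp.measurable
  constructor
  · unfold L2on
    refine MemLp.mono_measure Measure.restrict_le_self ?_
    rw [memLp_two_iff_integrable_sq hwm.aestronglyMeasurable]
    refine ⟨(hwm.pow_const 2).aestronglyMeasurable, ?_⟩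
    rw [hasFiniteIntegral_iff_enorm]
    have hm2 : Measurable (fun x : ℝ × ℝ => ‖w x.1 x.2‖ₑ ^ 2) := (w_meas' hw measurable_fst measurable_snd).enorm.pow_const 2
    have := mp.lintegral_comp hm2
    rw [← this] at hL
    simpa [enorm_pow] using hL
  · unfold GagH12
    rw [Measure.prod_restrict]
    refine Integrable.mono_measure ?_ Measure.restrict_le_self
    refine ⟨?_, ?_⟩
    · refine Measurable.aestronglyMeasurable ?_
      exact (((hwm.comp measurable_fst).sub (hwm.comp measurable_snd)).pow_const 2).div (by fun_prop)
    rw [hasFiniteIntegral_iff_enorm]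
    have mp2 := mp.prod mp
    have := mp2.lintegral_comp (NGint_meas w hw)
    rw [NG_prod w hw] at hN
    rw [Measure.volume_eq_prod (ℝ × ℝ) (ℝ × ℝ), ← this] at hN
    refine lt_of_eq_of_lt ?_ hN
    congr 1; ext q
    simp only [Prod.map]
    unfold kap
    rw [div_eq_mul_inv, enorm_mul, enorm_pow, one_div, norm_E2 (q.1 - q.2) i j hij, ← ofReal_norm (_⁻¹), Real.norm_of_nonneg (by positivity)]
    rfl

def V (i j : Fin 2) (m k g : ℝ → ℝ) (x : E2) : ℝ := Wf m k g (x i) (x j)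

theorem good_V (i j : Fin 2) (hij : i ≠ j) {m k g : ℝ → ℝ} (hm : Cc m) (hk : Cc k) (hgm : Measurable g) (hg : MemLp g 2) :
    Good (V i j m k g) :=
  good_of (Wf m k g) (Wf_meas m k g hm.nice.meas hk.nice.meas hgm) (NG_gen m k g hm.okm hk.okk hgm hg)
    (L2_gen m k g hm.okm hk.okk hgm hg) i j hij

theorem good_tensor (i j : Fin 2) (hij : i ≠ j) {a b : ℝ → ℝ} (ha : Cc a) (hb : Cc b) :
    Good (fun x => a (x i) * b (x j)) := by
  have ham := ha.nice.meas
  have hbm := hb.nice.meas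
  have hw : Measurable (Function.uncurry (fun s t => a s * b t)) :=
    (ham.comp measurable_fst).mul (hbm.comp measurable_snd)
  have ha2 := ha.okm.l2
  have hb2 := hb.okm.l2
  have hag := ha.okm.gag
  have hbg := hb.okm.gag
  refine good_of (fun s t => a s * b t) hw ?_ ?_ i j hij
  · refine (NG_le _ hw).trans_lt ?_
    have h1 : AG (fun s t => a s * b t) = Gag1 a * ∫⁻ t, ‖b t‖ₑ ^ 2 := by
      unfold AG Gag1
      rw [← lintegral_mul_const' _ _ hb2.ne]
      congr 1; ext s
      rw [← lintegral_mul_const' _ _ hb2.ne]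
      congr 1; ext s'
      rw [← lintegral_const_mul _ (hbm.enorm.pow_const 2)]
      congr 1; ext t
      rw [← sub_mul, enorm_mul, mul_pow, div_eq_mul_inv, div_eq_mul_inv]; ring
    have h2 : BG (fun s t => a s * b t) = Gag1 b * ∫⁻ t, ‖a t‖ₑ ^ 2 := by
      unfold BG Gag1
      rw [← lintegral_const_mul _ (ham.enorm.pow_const 2)]
      congr 1; ext s
      rw [← lintegral_mul_const' _ _ (by simp)]
      congr 1; ext t
      rw [← lintegral_mul_const' _ _ (by simp)]
      congr 1; ext t'
      rw [← mul_sub, enorm_mul, mul_pow, div_eq_mul_inv, div_eq_mul_inv]; ring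
    rw [h1, h2]
    finiteness
  · simp only [enorm_mul, mul_pow]
    rw [Measure.volume_eq_prod ℝ ℝ, lintegral_prod_mul (ham.enorm.pow_const 2).aemeasurable (hbm.enorm.pow_const 2).aemeasurable]
    finiteness

theorem Good.add {u v : E2 → ℝ} (hu : Good u) (hv : Good v) : Good (fun x => u x + v x) := by
  refine ⟨hu.1.add hv.1, ?_⟩
  have h := (hu.2.const_mul 2).add (hv.2.const_mul 2)
  refine h.mono' ?_ ?_
  · have m1 := hu.1.1
    have m2 := hv.1.1
    have m := m1.add m2
    refine AEStronglyMeasurable.div₀ ?_ (Measurable.aestronglyMeasurable (by fun_prop))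
    exact ((m.comp_fst).sub (m.comp_snd)).pow 2
  · filter_upwards with q
    rw [Real.norm_of_nonneg (by positivity)]
    simp only [Pi.add_apply]
    rw [← mul_div_assoc, ← mul_div_assoc, ← add_div]
    gcongr
    nlinarith [sq_nonneg ((u q.1 - u q.2) - (v q.1 - v q.2))]

theorem Good.smul {u : E2 → ℝ} (hu : Good u) (c : ℝ) : Good (fun x => c * u x) := by
  refine ⟨hu.1.const_mul c, ?_⟩
  have h := (hu.2.const_mul (c ^ 2))
  refine h.congr ?_
  filter_upwards with q
  ring

end part8

section part9
open scoped RealInnerProductSpace FourierTransform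

abbrev L1 : ℝ × ℝ →L[ℝ] ℝ := ContinuousLinearMap.fst ℝ ℝ ℝ
abbrev L2 : ℝ × ℝ →L[ℝ] ℝ := ContinuousLinearMap.snd ℝ ℝ ℝ

theorem param_diff (g : ℝ → ℝ) (hg : LocallyIntegrable g) (S : ℝ) (U : Set (ℝ × ℝ)) (hU : IsCompact U) (p0 : ℝ × ℝ)
    (hU0 : U ∈ nhds p0) (κ c1 c2 : ℝ × ℝ → ℝ → ℝ) (hκ : ContinuousOn (Function.uncurry κ) (U ×ˢ univ))
    (hc1 : ContinuousOn (Function.uncurry c1) (U ×ˢ univ)) (hc2 : ContinuousOn (Function.uncurry c2) (U ×ˢ univ))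
    (hd : ∀ p ∈ U, ∀ y, HasFDerivAt (fun p => κ p y) (c1 p y • L1 + c2 p y • L2) p) :
    HasFDerivAt (fun p => ∫ y in Icc (-S) S, g y * κ p y)
      ((∫ y in Icc (-S) S, g y * c1 p0 y) • L1 + (∫ y in Icc (-S) S, g y * c2 p0 y) • L2) p0 := by
  have hp0 : p0 ∈ U := mem_of_mem_nhds hU0
  have hgi : Integrable g (volume.restrict (Icc (-S) S)) := hg.integrableOn_isCompact isCompact_Icc
  have sub : U ×ˢ Icc (-S) S ⊆ U ×ˢ univ := prod_mono le_rfl (subset_univ _)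
  have slice : ∀ (c : ℝ × ℝ → ℝ → ℝ), ContinuousOn (Function.uncurry c) (U ×ˢ univ) → ∀ p ∈ U, Continuous (c p) := by
    intro c hc p hp
    rw [← continuousOn_univ]
    exact hc.comp (f := fun y => (p, y)) (by fun_prop) (fun y _ => ⟨hp, mem_univ _⟩)
  have bd : ∀ (c : ℝ × ℝ → ℝ → ℝ), ContinuousOn (Function.uncurry c) (U ×ˢ univ) →
      ∃ M, ∀ p ∈ U, ∀ y ∈ Icc (-S) S, |c p y| ≤ M := by
    intro c hc
    obtain ⟨M, hM⟩ := (hU.prod isCompact_Icc).exists_bound_of_continuousOn (hc.mono sub)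
    exact ⟨M, fun p hp y hy => hM (p, y) ⟨hp, hy⟩⟩
  have integ : ∀ (c : ℝ × ℝ → ℝ → ℝ), ContinuousOn (Function.uncurry c) (U ×ˢ univ) → ∀ p ∈ U,
      Integrable (fun y => g y * c p y) (volume.restrict (Icc (-S) S)) := by
    intro c hc p hp
    obtain ⟨M, hM⟩ := bd c hc
    refine (hgi.norm.mul_const M).mono' (hgi.1.mul (slice c hc p hp).aestronglyMeasurable) ?_
    filter_upwards [ae_restrict_mem measurableSet_Icc] with y hy
    rw [norm_mul]
    exact mul_le_mul_of_nonneg_left (hM p hp y hy) (norm_nonneg _)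
  obtain ⟨M1, hM1⟩ := bd c1 hc1
  obtain ⟨M2, hM2⟩ := bd c2 hc2
  have key := hasFDerivAt_integral_of_dominated_of_fderiv_le (μ := volume.restrict (Icc (-S) S)) (𝕜 := ℝ)
    (F := fun p y => g y * κ p y) (F' := fun p y => (g y * c1 p y) • L1 + (g y * c2 p y) • L2) (x₀ := p0) (s := U)
    (bound := fun y => ‖g y‖ * (M1 + M2)) hU0 ?_ (integ κ hκ p0 hp0) ?_ ?_ (hgi.norm.mul_const _) ?_
  · rw [integral_add, integral_smul_const, integral_smul_const] at key
    · exact key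
    · exact (integ c1 hc1 p0 hp0).smul_const _
    · exact (integ c2 hc2 p0 hp0).smul_const _
  · filter_upwards [hU0] with p hp
    exact (integ κ hκ p hp).1
  · exact AEStronglyMeasurable.add ((integ c1 hc1 p0 hp0).smul_const L1).1 ((integ c2 hc2 p0 hp0).smul_const L2).1
  · filter_upwards [ae_restrict_mem measurableSet_Icc] with y hy p hp
    refine (norm_add_le _ _).trans ?_
    rw [norm_smul, norm_smul, norm_mul, norm_mul, mul_add]
    have n1 : ‖L1‖ ≤ 1 := ContinuousLinearMap.norm_fst_le ..
    have n2 : ‖L2‖ ≤ 1 := ContinuousLinearMap.norm_snd_le ..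
    have := hM1 p hp y hy
    have := hM2 p hp y hy
    rw [← Real.norm_eq_abs] at *
    have q1 : ‖g y‖ * ‖c1 p y‖ * ‖L1‖ ≤ ‖g y‖ * ‖c1 p y‖ := mul_le_of_le_one_right (by positivity) n1
    have q2 : ‖g y‖ * ‖c2 p y‖ * ‖L2‖ ≤ ‖g y‖ * ‖c2 p y‖ := mul_le_of_le_one_right (by positivity) n2
    have : ‖g y‖ * ‖c1 p y‖ ≤ ‖g y‖ * M1 := by gcongr
    have : ‖g y‖ * ‖c2 p y‖ ≤ ‖g y‖ * M2 := by gcongr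
    linarith
  · filter_upwards with y p hp
    have := (hd p hp y).const_mul (g y)
    rwa [smul_add, smul_smul, smul_smul] at this

theorem Cc.deriv {k : ℝ → ℝ} (hk : Cc k) : Cc (deriv k) :=
  ⟨(contDiff_infty_iff_deriv.1 hk.smooth).2, hk.supp.deriv⟩

theorem Cc.idmul {k : ℝ → ℝ} (hk : Cc k) : Cc (fun y => y * k y) :=
  ⟨contDiff_id.mul hk.smooth, hk.supp.mul_left⟩

theorem Cc.smulc {k : ℝ → ℝ} (hk : Cc k) (c : ℝ) : Cc (fun y => c * k y) :=
  ⟨contDiff_const.mul hk.smooth, hk.supp.mul_left⟩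

theorem Cc.add {k l : ℝ → ℝ} (hk : Cc k) (hl : Cc l) : Cc (fun y => k y + l y) :=
  ⟨hk.smooth.add hl.smooth, hk.supp.add hl.supp⟩

/-- differentiation under the integral, `C¹` version -/
theorem Tf_diffC1 (k f f' : ℝ → ℝ) (hk : Cc k) (hf : ∀ t, HasDerivAt f (f' t) t) (hf' : Continuous f') (p : ℝ × ℝ) :
    HasFDerivAt (fun p : ℝ × ℝ => Tf k f p.1 p.2)
      (Tf (fun y => y * k y) f' p.1 p.2 • L1 + Tf k f' p.1 p.2 • L2) p := by
  obtain ⟨R, hR, hs⟩ := hk.supp_Icc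
  have hfc : Continuous f := continuous_iff_continuousAt.2 fun t => (hf t).continuousAt
  have hkc := hk.smooth.continuous
  have loc : ∀ (F : ℝ → ℝ), (∀ y, R < |y| → F y = 0) → ∫ y, F y = ∫ y in Icc (-R) R, F y := by
    intro F hF
    symm
    apply setIntegral_eq_integral_of_forall_compl_eq_zero
    intro y hy
    apply hF
    by_contra h
    exact hy (abs_le.1 (not_lt.1 h))
  have e1 : (fun p : ℝ × ℝ => Tf k f p.1 p.2) = fun p => ∫ y in Icc (-R) R, k y * f (p.2 + p.1 * y) := by
    ext p; unfold Tf
    rw [loc _ (fun y hy => by simp [hs y hy])]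
    simp_rw [mul_comm]
  have e2 : Tf (fun y => y * k y) f' p.1 p.2 = ∫ y in Icc (-R) R, k y * (y * f' (p.2 + p.1 * y)) := by
    unfold Tf
    rw [loc _ (fun y hy => by simp [hs y hy])]
    congr 1; ext y; ring
  have e3 : Tf k f' p.1 p.2 = ∫ y in Icc (-R) R, k y * f' (p.2 + p.1 * y) := by
    unfold Tf
    rw [loc _ (fun y hy => by simp [hs y hy])]
    simp_rw [mul_comm]
  rw [e1, e2, e3]
  obtain ⟨U, hUc, hU⟩ := exists_compact_mem_nhds p
  refine param_diff k hkc.locallyIntegrable R U hUc p hU (fun p y => f (p.2 + p.1 * y)) (fun p y => y * f' (p.2 + p.1 * y))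
    (fun p y => f' (p.2 + p.1 * y)) ?_ ?_ ?_ ?_
  · exact Continuous.continuousOn (by unfold Function.uncurry; fun_prop)
  · exact Continuous.continuousOn (by unfold Function.uncurry; fun_prop)
  · exact Continuous.continuousOn (by unfold Function.uncurry; fun_prop)
  · intro p _ y
    have h1 : HasFDerivAt (fun p : ℝ × ℝ => p.2 + p.1 * y) (L2 + y • L1) p :=
      hasFDerivAt_snd.add (hasFDerivAt_fst.mul_const y)
    have h2 := (hf (p.2 + p.1 * y)).comp_hasFDerivAt p h1
    refine h2.congr_fderiv ?_
    ext <;> simp [mul_comm]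

theorem Tf_cont (k f : ℝ → ℝ) (hk : Cc k) (hf : Continuous f) : Continuous (fun p : ℝ × ℝ => Tf k f p.1 p.2) := by
  obtain ⟨R, hR, hs⟩ := hk.supp_Icc
  have hkc := hk.smooth.continuous
  have e1 : (fun p : ℝ × ℝ => Tf k f p.1 p.2) = fun p => ∫ y in Icc (-R) R, f (p.2 + p.1 * y) * k y := by
    ext p; unfold Tf
    symm
    apply setIntegral_eq_integral_of_forall_compl_eq_zero
    intro y hy
    rw [hs y, mul_zero]
    by_contra h
    exact hy (abs_le.1 (not_lt.1 h))
  rw [e1]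
  exact continuous_parametric_integral_of_continuous (f := fun (p : ℝ × ℝ) y => f (p.2 + p.1 * y) * k y)
    (by unfold Function.uncurry; fun_prop) isCompact_Icc

theorem Tf_kernel (k g : ℝ → ℝ) (a b : ℝ) (ha : 0 < a) : Tf k g a b = ∫ s, g s * (a⁻¹ * k ((s - b) * a⁻¹)) := by
  unfold Tf
  have h1 := integral_add_right_eq_self (μ := volume) (fun s => g s * (a⁻¹ * k ((s - b) * a⁻¹))) b
  rw [← h1]
  have h2 := Measure.integral_comp_mul_left (fun s => g (s + b) * (a⁻¹ * k ((s + b - b) * a⁻¹))) a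
  have h3 : ∫ s, g (s + b) * (a⁻¹ * k ((s + b - b) * a⁻¹)) = a * ∫ x, g (a * x + b) * (a⁻¹ * k ((a * x + b - b) * a⁻¹)) := by
    rw [h2, abs_of_pos (inv_pos.2 ha), smul_eq_mul, ← mul_assoc, mul_inv_cancel₀ ha.ne', one_mul]
  rw [h3, ← integral_const_mul]
  congr 1; ext y
  have : (a * y + b - b) * a⁻¹ = y := by field_simp; ring
  rw [this, add_comm b]
  field_simp

/-- differentiation, weak version -/
theorem Tf_diffW (k g g' : ℝ → ℝ) (hk : Cc k) (hg : LocallyIntegrable g) (hw : IsWeakD1 univ g g') (p0 : ℝ × ℝ) (hp0 : 0 < p0.1) :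
    HasFDerivAt (fun p : ℝ × ℝ => Tf k g p.1 p.2)
      (Tf (fun y => y * k y) g' p0.1 p0.2 • L1 + Tf k g' p0.1 p0.2 • L2) p0 := by
  obtain ⟨R, hR, hs⟩ := hk.supp_Icc
  have hkc := hk.smooth.continuous
  have hk'c := hk.deriv.smooth.continuous
  have hkd : ∀ t, HasDerivAt k (deriv k t) t := fun t => ((hk.smooth.differentiable (by simp)) t).hasDerivAt
  obtain ⟨a0, b0⟩ := p0
  simp only at hp0 ⊢
  set U : Set (ℝ × ℝ) := Icc (a0/2) (2*a0) ×ˢ Icc (b0 - 1) (b0 + 1) with hUdef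
  have hUc : IsCompact U := isCompact_Icc.prod isCompact_Icc
  have hU : U ∈ nhds (a0, b0) := prod_mem_nhds (Icc_mem_nhds (by linarith) (by linarith)) (Icc_mem_nhds (by linarith) (by linarith))
  set S := |b0| + 1 + 2 * a0 * R with hS
  have hloc : ∀ (l : ℝ → ℝ), (∀ y, R < |y| → l y = 0) → ∀ p ∈ U, ∀ s, s ∉ Icc (-S) S → l ((s - p.2) * p.1⁻¹) = 0 := by
    intro l hl p hp s hsS
    apply hl
    have hp1 : 0 < p.1 := by have := hp.1.1; linarith
    rw [← div_eq_mul_inv, abs_div, abs_of_pos hp1, lt_div_iff₀ hp1]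
    have : S < |s| := by by_contra h; exact hsS (abs_le.1 (not_lt.1 h))
    have h1 : |s| ≤ |s - p.2| + |p.2| := by have := abs_add_le (s - p.2) p.2; simpa using this
    have h2 : |p.2| ≤ |b0| + 1 := by
      have h3 : |p.2 - b0| ≤ 1 := abs_le.2 ⟨by have := hp.2.1; linarith, by have := hp.2.2; linarith⟩
      have := abs_add_le (p.2 - b0) b0
      simp at this; linarith
    have h3 : R * p.1 ≤ 2 * a0 * R := by have := hp.1.2; nlinarith
    linarith
  have ci : ContinuousOn (fun q : (ℝ × ℝ) × ℝ => q.1.1⁻¹) (U ×ˢ univ) := by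
    apply ContinuousOn.inv₀ (by fun_prop)
    rintro q ⟨hq, -⟩ h
    have := hq.1.1; linarith
  have ca : ContinuousOn (fun q : (ℝ × ℝ) × ℝ => (q.2 - q.1.2) * q.1.1⁻¹) (U ×ˢ univ) :=
    ContinuousOn.mul (by fun_prop) ci
  have key := param_diff g hg S U hUc (a0, b0) hU (fun p s => p.1⁻¹ * k ((s - p.2) * p.1⁻¹))
    (fun p s => - (p.1⁻¹ ^ 2 * (k ((s - p.2) * p.1⁻¹) + ((s - p.2) * p.1⁻¹) * deriv k ((s - p.2) * p.1⁻¹))))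
    (fun p s => - (p.1⁻¹ ^ 2 * deriv k ((s - p.2) * p.1⁻¹))) ?_ ?_ ?_ ?_
  · have E : (fun p : ℝ × ℝ => Tf k g p.1 p.2) =ᶠ[nhds (a0, b0)] fun p => ∫ s in Icc (-S) S, g s * (p.1⁻¹ * k ((s - p.2) * p.1⁻¹)) := by
      filter_upwards [hU] with p hp
      have hp1 : 0 < p.1 := by have := hp.1.1; linarith
      rw [Tf_kernel k g _ _ hp1]
      symm
      apply setIntegral_eq_integral_of_forall_compl_eq_zero
      intro s hsS
      rw [hloc k hs p hp s hsS]; simp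
    refine (key.congr_of_eventuallyEq E).congr_fderiv ?_
    have hmem : (a0, b0) ∈ U := mem_of_mem_nhds hU
    have full : ∀ l : ℝ → ℝ, Cc l → Tf l g' a0 b0 = - ∫ s, g s * (a0⁻¹ ^ 2 * deriv l ((s - b0) * a0⁻¹)) := by
      intro l hl
      rw [Tf_kernel l g' _ _ hp0]
      have hld : ∀ t, HasDerivAt l (deriv l t) t := fun t => ((hl.smooth.differentiable (by simp)) t).hasDerivAt
      have hd : ∀ s, deriv (fun s => a0⁻¹ * l ((s - b0) * a0⁻¹)) s = a0⁻¹ ^ 2 * deriv l ((s - b0) * a0⁻¹) := by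
        intro s
        have h1 : HasDerivAt (fun s => (s - b0) * a0⁻¹) (1 * a0⁻¹) s := ((hasDerivAt_id s).sub_const b0).mul_const _
        have := ((hld _).comp s h1).const_mul a0⁻¹
        refine this.deriv.trans ?_
        ring
      have hcs : HasCompactSupport (fun s => a0⁻¹ * l ((s - b0) * a0⁻¹)) := by
        obtain ⟨R', hR', hs'⟩ := hl.supp_Icc
        apply HasCompactSupport.intro (K := Icc (-(|b0| + a0 * R')) (|b0| + a0 * R')) isCompact_Icc
        intro s hsS
        have : |b0| + a0 * R' < |s| := by by_contra h; exact hsS (abs_le.1 (not_lt.1 h))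
        have h1 : |s| ≤ |s - b0| + |b0| := by have := abs_add_le (s - b0) b0; simpa using this
        rw [hs', mul_zero]
        rw [← div_eq_mul_inv, abs_div, abs_of_pos hp0, lt_div_iff₀ hp0]
        linarith
      have := hw (fun s => a0⁻¹ * l ((s - b0) * a0⁻¹)) (contDiff_const.mul (hl.smooth.comp (by fun_prop))) hcs (subset_univ _)
      simp only [Measure.restrict_univ, hd] at this
      rw [this]; simp
    have ext1 : ∀ l : ℝ → ℝ, (∀ y, R < |y| → l y = 0) →
        - ∫ s, g s * (a0⁻¹ ^ 2 * l ((s - b0) * a0⁻¹)) = ∫ s in Icc (-S) S, g s * -(a0⁻¹ ^ 2 * l ((s - b0) * a0⁻¹)) := by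
      intro l hl
      rw [← integral_neg]
      simp_rw [mul_neg]
      symm
      apply setIntegral_eq_integral_of_forall_compl_eq_zero
      intro s hsS
      rw [hloc l hl (a0, b0) hmem s hsS]; simp
    have hdz : ∀ y, R < |y| → deriv k y = 0 := by
      intro y hy
      have : k =ᶠ[nhds y] fun _ => 0 := by
        filter_upwards [continuous_abs.continuousAt.eventually (lt_mem_nhds hy)] with z hz using hs z hz
      rw [this.deriv_eq]; simp
    have hdi : deriv (fun y => y * k y) = fun y => k y + y * deriv k y := by
      ext y
      refine (((hasDerivAt_id y).mul (hkd y)).deriv).trans ?_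
      simp
    have ee := ext1 (fun y => k y + y * deriv k y) (fun y hy => by simp [hs y hy, hdz y hy])
    rw [full _ hk.idmul, full _ hk, hdi, ext1 _ hdz, ee]
  · exact ci.mul (hkc.comp_continuousOn ca)
  · exact ((ci.pow 2).mul ((hkc.comp_continuousOn ca).add (ca.mul (hk'c.comp_continuousOn ca)))).neg
  · exact ((ci.pow 2).mul (hk'c.comp_continuousOn ca)).neg
  · intro p hp s
    have hp1 : p.1 ≠ 0 := by have := hp.1.1; intro h; linarith
    have i1 : HasFDerivAt (fun p : ℝ × ℝ => p.1⁻¹) ((-(p.1 ^ 2)⁻¹) • L1) p :=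
      (hasDerivAt_inv hp1).comp_hasFDerivAt p hasFDerivAt_fst
    have i2 : HasFDerivAt (fun p : ℝ × ℝ => s - p.2) (-L2) p := hasFDerivAt_snd.const_sub s
    have i3 := i2.mul i1
    have i4 := i1.mul ((hkd ((s - p.2) * p.1⁻¹)).comp_hasFDerivAt p i3)
    refine i4.congr_fderiv ?_
    ext <;> simp <;> field_simp <;> ring

end part9

section part10
open scoped RealInnerProductSpace FourierTransform

abbrev pr (i : Fin 2) : E2 →L[ℝ] ℝ := EuclideanSpace.proj i

theorem Cc.hasDerivAt {m : ℝ → ℝ} (hm : Cc m) (t : ℝ) : HasDerivAt m (_root_.deriv m t) t :=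
  ((hm.smooth.differentiable (by simp)) t).hasDerivAt

theorem V_diff_aux (i j : Fin 2) (m k g g' : ℝ → ℝ) (hm : Cc m) (x : E2)
    (h : HasFDerivAt (fun p : ℝ × ℝ => Tf k g p.1 p.2)
      (Tf (fun y => y * k y) g' (x i) (x j) • L1 + Tf k g' (x i) (x j) • L2) (x i, x j)) :
    HasFDerivAt (V i j m k g)
      ((V i j (deriv m) k g x + V i j m (fun y => y * k y) g' x) • pr i + V i j m k g' x • pr j) x := by
  have h1 : HasFDerivAt (fun x : E2 => (x i, x j)) ((pr i).prod (pr j)) x :=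
    ((pr i).prod (pr j)).hasFDerivAt
  have h2 := HasFDerivAt.comp x h h1
  have h3 : HasFDerivAt (fun x : E2 => m (x i)) (deriv m (x i) • pr i) x :=
    (hm.hasDerivAt (x i)).comp_hasFDerivAt x (pr i).hasFDerivAt
  have h4 := h3.mul h2
  refine (h4.congr_of_eventuallyEq (Filter.Eventually.of_forall fun z => ?_)).congr_fderiv ?_
  · simp [V, Wf]
  · ext v
    simp [V, Wf]
    ring

theorem V_diffC1 (i j : Fin 2) (m k f f' : ℝ → ℝ) (hm : Cc m) (hk : Cc k) (hf : ∀ t, HasDerivAt f (f' t) t)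
    (hf' : Continuous f') (x : E2) :
    HasFDerivAt (V i j m k f)
      ((V i j (deriv m) k f x + V i j m (fun y => y * k y) f' x) • pr i + V i j m k f' x • pr j) x :=
  V_diff_aux i j m k f f' hm x (Tf_diffC1 k f f' hk hf hf' (x i, x j))

theorem V_diffW (i j : Fin 2) (m k g g' : ℝ → ℝ) (hm : Cc m) (hk : Cc k) (hg : LocallyIntegrable g)
    (hw : IsWeakD1 univ g g') (x : E2) (hx : 0 < x i) :
    HasFDerivAt (V i j m k g)
      ((V i j (deriv m) k g x + V i j m (fun y => y * k y) g' x) • pr i + V i j m k g' x • pr j) x :=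
  V_diff_aux i j m k g g' hm x (Tf_diffW k g g' hk hg hw (x i, x j) hx)

theorem V_cont (i j : Fin 2) (m k f : ℝ → ℝ) (hm : Cc m) (hk : Cc k) (hf : Continuous f) : Continuous (V i j m k f) := by
  unfold V Wf
  have h1 := (Tf_cont k f hk hf).comp (g := fun p : ℝ × ℝ => Tf k f p.1 p.2) (f := fun x : E2 => (x i, x j)) (by fun_prop)
  have h2 : Continuous (fun x : E2 => m (x i)) := hm.smooth.continuous.comp (by fun_prop)
  exact h2.mul h1

def MyH52 (ζ : E2 → ℝ) : Prop :=
  ∃ (G : Fin 2 → E2 → ℝ) (Hs : Fin 2 → Fin 2 → E2 → ℝ),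
    (∀ x ∈ quadrant, HasFDerivAt ζ (∑ d, G d x • pr d) x) ∧
    (∀ d, ∀ x ∈ quadrant, HasFDerivAt (G d) (∑ d', Hs d d' x • pr d') x) ∧
    Good ζ ∧ (∀ d, Good (G d)) ∧ ∀ d d', Good (Hs d d')

theorem MyH52.mk (i j : Fin 2) (hij : i ≠ j) (ζ Gi Gj Hii Hij Hji Hjj : E2 → ℝ)
    (h : ∀ x ∈ quadrant, HasFDerivAt ζ (Gi x • pr i + Gj x • pr j) x)
    (hi : ∀ x ∈ quadrant, HasFDerivAt Gi (Hii x • pr i + Hij x • pr j) x)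
    (hj : ∀ x ∈ quadrant, HasFDerivAt Gj (Hji x • pr i + Hjj x • pr j) x)
    (g : Good ζ) (gi : Good Gi) (gj : Good Gj) (gii : Good Hii) (gij : Good Hij) (gji : Good Hji) (gjj : Good Hjj) :
    MyH52 ζ := by
  have key : (i = 0 ∧ j = 1) ∨ (i = 1 ∧ j = 0) := by omega
  rcases key with ⟨rfl, rfl⟩ | ⟨rfl, rfl⟩
  · refine ⟨![Gi, Gj], ![![Hii, Hij], ![Hji, Hjj]], ?_, ?_, g, ?_, ?_⟩
    · simpa [Fin.sum_univ_two] using h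
    · simp only [Fin.forall_fin_two, Fin.sum_univ_two]
      exact ⟨hi, hj⟩
    · simp only [Fin.forall_fin_two]
      exact ⟨gi, gj⟩
    · simp only [Fin.forall_fin_two]
      exact ⟨⟨gii, gij⟩, gji, gjj⟩
  · refine ⟨![Gj, Gi], ![![Hjj, Hji], ![Hij, Hii]], ?_, ?_, g, ?_, ?_⟩
    · simpa [Fin.sum_univ_two, add_comm] using h
    · simp only [Fin.forall_fin_two, Fin.sum_univ_two]
      refine ⟨fun x hx => ?_, fun x hx => ?_⟩
      · exact (hj x hx).congr_fderiv (add_comm _ _)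
      · exact (hi x hx).congr_fderiv (add_comm _ _)
    · simp only [Fin.forall_fin_two]
      exact ⟨gj, gi⟩
    · simp only [Fin.forall_fin_two]
      exact ⟨⟨gjj, gji⟩, gij, gii⟩

theorem MyH52.add {u v : E2 → ℝ} (hu : MyH52 u) (hv : MyH52 v) : MyH52 (fun x => u x + v x) := by
  obtain ⟨G, H, a1, a2, a3, a4, a5⟩ := hu
  obtain ⟨G', H', b1, b2, b3, b4, b5⟩ := hv
  refine ⟨fun d x => G d x + G' d x, fun d d' x => H d d' x + H' d d' x, ?_, ?_, a3.add b3, fun d => (a4 d).add (b4 d),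
    fun d d' => (a5 d d').add (b5 d d')⟩
  · intro x hx
    refine ((a1 x hx).add (b1 x hx)).congr_fderiv ?_
    simp [add_smul, Finset.sum_add_distrib]
  · intro d x hx
    refine ((a2 d x hx).add (b2 d x hx)).congr_fderiv ?_
    simp [add_smul, Finset.sum_add_distrib]

theorem MyH52.smul {u : E2 → ℝ} (hu : MyH52 u) (c : ℝ) : MyH52 (fun x => c * u x) := by
  obtain ⟨G, H, a1, a2, a3, a4, a5⟩ := hu
  refine ⟨fun d x => c * G d x, fun d d' x => c * H d d' x, ?_, ?_, a3.smul c, fun d => (a4 d).smul c,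
    fun d d' => (a5 d d').smul c⟩
  · intro x hx
    refine ((a1 x hx).const_mul c).congr_fderiv ?_
    simp [mul_smul]
  · intro d x hx
    refine ((a2 d x hx).const_mul c).congr_fderiv ?_
    simp [mul_smul]

theorem quad_pos (i : Fin 2) (x : E2) (hx : x ∈ quadrant) : 0 < x i := by
  fin_cases i
  · exact hx.1
  · exact hx.2

structure L2m (g : ℝ → ℝ) : Prop where
  meas : Measurable g
  lp : MemLp g 2

theorem L2m.loc {g : ℝ → ℝ} (h : L2m g) : LocallyIntegrable g := h.lp.locallyIntegrable (by norm_num)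

theorem L2m.good {g : ℝ → ℝ} (h : L2m g) {i j : Fin 2} (hij : i ≠ j) {m k : ℝ → ℝ} (hm : Cc m) (hk : Cc k) :
    Good (V i j m k g) := good_V i j hij hm hk h.meas h.lp

/-- the value piece -/
theorem piece_E (i j : Fin 2) (hij : i ≠ j) (m k φ d e : ℝ → ℝ) (hm : Cc m) (hk : Cc k) (hφ : L2m φ) (hd : L2m d)
    (he : L2m e) (h1 : ∀ t, HasDerivAt φ (d t) t) (hdc : Continuous d) (hw : IsWeakD1 univ d e) :
    MyH52 (V i j m k φ) := by
  refine MyH52.mk i j hij _ _ _ (fun x =>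
      (V i j (deriv (deriv m)) k φ x + V i j (deriv m) (fun y => y * k y) d x) +
      (V i j (deriv m) (fun y => y * k y) d x + V i j m (fun y => y * (y * k y)) e x))
      (fun x => V i j (deriv m) k d x + V i j m (fun y => y * k y) e x) _ _
    (fun x _ => V_diffC1 i j m k φ d hm hk h1 hdc x)
    (fun x hx => ?_) (fun x hx => V_diffW i j m k d e hm hk hd.loc hw x (quad_pos i x hx)) (hφ.good hij hm hk)
    ((hφ.good hij hm.deriv hk).add (hd.good hij hm hk.idmul)) (hd.good hij hm hk) ?_ ?_ ?_ (he.good hij hm hk)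
  · have a := V_diffC1 i j (deriv m) k φ d hm.deriv hk h1 hdc x
    have b := V_diffW i j m (fun y => y * k y) d e hm hk.idmul hd.loc hw x (quad_pos i x hx)
    refine (a.add b).congr_fderiv ?_
    module
  · exact ((hφ.good hij hm.deriv.deriv hk).add (hd.good hij hm.deriv hk.idmul)).add
      ((hd.good hij hm.deriv hk.idmul).add (he.good hij hm hk.idmul.idmul))
  · exact (hd.good hij hm.deriv hk).add (he.good hij hm hk.idmul)
  · exact (hd.good hij hm.deriv hk).add (he.good hij hm hk.idmul)

theorem Tf_parts (k f f' : ℝ → ℝ) (hk : Cc k) (h1 : ∀ t, HasDerivAt f (f' t) t) (hc : Continuous f') (a b : ℝ) :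
    Tf (deriv k) f a b = - (a * Tf k f' a b) := by
  unfold Tf
  have hfc : Continuous f := continuous_iff_continuousAt.2 fun t => (h1 t).continuousAt
  have hd : ∀ y, HasDerivAt (fun y => f (b + a * y)) (f' (b + a * y) * a) y := by
    intro y
    have : HasDerivAt (fun y => b + a * y) (a * 1) y := ((hasDerivAt_id y).const_mul a).const_add b
    rw [mul_one] at this
    exact (h1 _).comp y this
  have cs : ∀ (F k : ℝ → ℝ), Continuous F → Cc k → Integrable (F * k) := fun F k hF hk =>
    (hF.mul hk.smooth.continuous).integrable_of_hasCompactSupport hk.supp.mul_left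
  have := integral_mul_deriv_eq_deriv_mul_of_integrable (u := fun y => f (b + a * y)) (v := k) (u' := fun y => f' (b + a * y) * a)
    (v' := deriv k) (fun x _ => hd x) (fun x _ => hk.hasDerivAt x) (cs _ _ (by fun_prop) hk.deriv) (cs _ _ (by fun_prop) hk) (cs _ _ (by fun_prop) hk)
  rw [this, ← integral_const_mul]
  congr 2; ext y; ring

theorem V_parts (i j : Fin 2) (m k f f' : ℝ → ℝ) (hk : Cc k) (h1 : ∀ t, HasDerivAt f (f' t) t) (hc : Continuous f') (x : E2) :
    V i j m (deriv k) f x = - V i j (fun s => s * m s) k f' x := by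
  unfold V Wf
  rw [Tf_parts k f f' hk h1 hc]
  ring

/-- the normal derivative piece -/
theorem piece_F (i j : Fin 2) (hij : i ≠ j) (m k Ψ ψ ψ' : ℝ → ℝ) (hm : Cc m) (hk : Cc k) (hψ : L2m ψ) (hψ' : L2m ψ')
    (h1 : ∀ t, HasDerivAt Ψ (ψ t) t) (hc : Continuous ψ) (hw : IsWeakD1 univ ψ ψ') :
    MyH52 (V i j m (deriv k) Ψ) := by
  have P : ∀ m, V i j m (deriv k) Ψ = fun x => (-1) * V i j (fun s => s * m s) k ψ x := by
    intro m; ext x; rw [V_parts i j m k Ψ ψ hk h1 hc]; ring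
  have D : ∀ m k, Cc m → Cc k → ∀ x ∈ quadrant, HasFDerivAt (V i j m k ψ)
      ((V i j (deriv m) k ψ x + V i j m (fun y => y * k y) ψ' x) • pr i + V i j m k ψ' x • pr j) x :=
    fun m k hm hk x hx => V_diffW i j m k ψ ψ' hm hk hψ.loc hw x (quad_pos i x hx)
  refine MyH52.mk i j hij _ (fun x => (-1) * V i j (fun s => s * deriv m s) k ψ x + V i j m (fun y => y * deriv k y) ψ x) _
    (fun x => (-1) * (V i j (deriv (fun s => s * deriv m s)) k ψ x + V i j (fun s => s * deriv m s) (fun y => y * k y) ψ' x)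
      + (V i j (deriv m) (fun y => y * deriv k y) ψ x + V i j m (fun y => y * (y * deriv k y)) ψ' x))
    (fun x => (-1) * V i j (fun s => s * deriv m s) k ψ' x + V i j m (fun y => y * deriv k y) ψ' x) _ _
    (fun x _ => ?_)
    (fun x hx => ?_) (fun x hx => D m (deriv k) hm hk.deriv x hx) ?_ ?_ (hψ.good hij hm hk.deriv) ?_ ?_ ?_ (hψ'.good hij hm hk.deriv)
  · have := V_diffC1 i j m (deriv k) Ψ ψ hm hk.deriv h1 hc x
    rwa [P (deriv m)] at this
  · refine (((D _ k hm.deriv.idmul hk x hx).const_mul (-1)).add (D m _ hm hk.deriv.idmul x hx)).congr_fderiv ?_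
    module
  · rw [P]; exact (hψ.good hij hm.idmul hk).smul (-1)
  · exact ((hψ.good hij hm.deriv.idmul hk).smul (-1)).add (hψ.good hij hm hk.deriv.idmul)
  · exact (((hψ.good hij hm.deriv.idmul.deriv hk).add (hψ'.good hij hm.deriv.idmul hk.idmul)).smul (-1)).add
      ((hψ.good hij hm.deriv hk.deriv.idmul).add (hψ'.good hij hm hk.deriv.idmul.idmul))
  · exact ((hψ'.good hij hm.deriv.idmul hk).smul (-1)).add (hψ'.good hij hm hk.deriv.idmul)
  · exact (hψ.good hij hm.deriv hk.deriv).add (hψ'.good hij hm hk.deriv.idmul)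

/-- tensor piece -/
theorem piece_T (i j : Fin 2) (hij : i ≠ j) (a b : ℝ → ℝ) (ha : Cc a) (hb : Cc b) : MyH52 (fun x => a (x i) * b (x j)) := by
  have D : ∀ a b, Cc a → Cc b → ∀ x : E2, HasFDerivAt (fun x : E2 => a (x i) * b (x j))
      ((deriv a (x i) * b (x j)) • pr i + (a (x i) * deriv b (x j)) • pr j) x := by
    intro a b ha hb x
    have h3 : HasFDerivAt (fun x : E2 => a (x i)) (deriv a (x i) • pr i) x :=
      (ha.hasDerivAt (x i)).comp_hasFDerivAt x (pr i).hasFDerivAt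
    have h4 : HasFDerivAt (fun x : E2 => b (x j)) (deriv b (x j) • pr j) x :=
      (hb.hasDerivAt (x j)).comp_hasFDerivAt x (pr j).hasFDerivAt
    refine (h3.mul h4).congr_fderiv ?_
    module
  have T : ∀ a b, Cc a → Cc b → Good (fun x : E2 => a (x i) * b (x j)) := fun a b ha hb => good_tensor i j hij ha hb
  exact MyH52.mk i j hij _ _ _ _ _ _ _ (fun x _ => D a b ha hb x) (fun x _ => D _ b ha.deriv hb x) (fun x _ => D a _ ha hb.deriv x)
    (T _ _ ha hb) (T _ _ ha.deriv hb) (T _ _ ha hb.deriv) (T _ _ ha.deriv.deriv hb) (T _ _ ha.deriv hb.deriv) (T _ _ ha.deriv hb.deriv)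
    (T _ _ ha hb.deriv.deriv)

end part10

section part11
open scoped RealInnerProductSpace FourierTransform

theorem prod_int_quad (u w : E2 → ℝ) (hu : L2on quadrant u) (hw : Continuous w) (hs : HasCompactSupport w)
    (hq : tsupport w ⊆ quadrant) : Integrable (fun x => u x * w x) := by
  have hw2 : MemLp w 2 (volume.restrict quadrant) := (hw.memLp_of_hasCompactSupport hs).mono_measure Measure.restrict_le_self
  have h : IntegrableOn (fun x => u x * w x) quadrant := MemLp.integrable_mul hu hw2
  rwa [integrableOn_iff_integrable_of_support_subset] at h
  refine subset_trans (fun x hx => ?_) hq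
  apply subset_tsupport
  intro h0
  apply hx
  simp [h0]

theorem weakD_of_hasFDerivAt (u v : E2 → ℝ) (u' : E2 → E2 →L[ℝ] ℝ) (e : E2) (hu : L2on quadrant u) (hv : L2on quadrant v)
    (h : ∀ x ∈ quadrant, HasFDerivAt u (u' x) x) (hv' : ∀ x, u' x e = v x) : IsWeakD quadrant u v e := by
  intro φ hφ hs hq
  have hφ1 : ContDiff ℝ 1 φ := hφ.of_le (by exact_mod_cast le_top)
  have hfc : Continuous (fun x => fderiv ℝ φ x e) := (hφ1.continuous_fderiv (by simp)).clm_apply continuous_const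
  have hts : tsupport (fun x => fderiv ℝ φ x e) ⊆ tsupport φ := tsupport_fderiv_apply_subset ℝ e
  have z1 : ∀ x, x ∉ quadrant → φ x = 0 := fun x hx => image_eq_zero_of_notMem_tsupport fun h => hx (hq h)
  have z2 : ∀ x, x ∉ quadrant → fderiv ℝ φ x e = 0 := fun x hx =>
    image_eq_zero_of_notMem_tsupport (f := fun x => fderiv ℝ φ x e) fun h => hx (hq (hts h))
  rw [setIntegral_eq_integral_of_forall_compl_eq_zero (fun x hx => by rw [z2 x hx, mul_zero]),
    setIntegral_eq_integral_of_forall_compl_eq_zero (fun x hx => by rw [z1 x hx, mul_zero])]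
  have := integral_bilinear_hasFDerivAt_right_eq_neg_left_of_integrable (μ := volume) (B := ContinuousLinearMap.mul ℝ ℝ)
    (f := u) (f' := u') (g := φ) (g' := fderiv ℝ φ) (v := e) ?_ ?_ ?_ (fun x hx => h x (hq hx))
    (fun x _ => (hφ1.differentiable (by simp) x).hasFDerivAt)
  · simpa [hv'] using this
  · simpa [hv'] using prod_int_quad v φ hv hφ1.continuous hs hq
  · simpa using prod_int_quad u _ hu hfc (HasCompactSupport.fderiv_apply ℝ hs e) (hts.trans hq)
  · simpa using prod_int_quad u φ hu hφ1.continuous hs hq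

theorem MyH52.memH52 {ζ : E2 → ℝ} (h : MyH52 ζ) : MemH52 quadrant ζ := by
  obtain ⟨G, H, a1, a2, a3, a4, a5⟩ := h
  refine ⟨G, H, ⟨a3.1, fun d => ⟨(a4 d).1, ?_⟩, fun d d' => ⟨(a5 d d').1, ?_⟩⟩, fun d d' => (a5 d d').2⟩
  · refine weakD_of_hasFDerivAt _ _ _ _ a3.1 (a4 d).1 a1 (fun x => ?_)
    fin_cases d <;> simp [Fin.sum_univ_two]
  · refine weakD_of_hasFDerivAt _ _ _ _ (a4 d).1 (a5 d d').1 (a2 d) (fun x => ?_)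
    fin_cases d' <;> simp [Fin.sum_univ_two]

end part11

section part12
open scoped RealInnerProductSpace FourierTransform

theorem exists_chi : ∃ χ : ℝ → ℝ, Cc χ ∧ χ 0 = 1 ∧ deriv χ 0 = 0 := by
  let f : ContDiffBump (0:ℝ) := ⟨1, 2, by norm_num, by norm_num⟩
  refine ⟨f, ⟨f.contDiff, f.hasCompactSupport⟩, f.one_of_mem_closedBall (by simp [f]), ?_⟩
  have := f.eventuallyEq_one
  rw [this.deriv_eq]
  simp [Pi.one_def]

theorem exists_rho : ∃ ρ : ℝ → ℝ, Cc ρ ∧ (∫ y, ρ y = 1) ∧ ∀ y, 0 ≤ y → ρ y = 0 ∧ deriv ρ y = 0 := by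
  let f : ContDiffBump (-1/2:ℝ) := ⟨1/8, 1/4, by norm_num, by norm_num⟩
  refine ⟨f.normed volume, ⟨f.contDiff_normed, f.hasCompactSupport_normed⟩, f.integral_normed, ?_⟩
  intro y hy
  have h : y ∉ tsupport (f.normed volume) := by
    rw [f.tsupport_normed_eq, Metric.mem_closedBall, Real.dist_eq]
    intro h
    have := (abs_le.1 h).2
    have e : f.rOut = 1/4 := rfl
    rw [e] at this
    linarith
  refine ⟨image_eq_zero_of_notMem_tsupport h, ?_⟩
  rw [(notMem_tsupport_iff_eventuallyEq.1 h).deriv_eq]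
  simp [Pi.zero_def]

theorem Tf_zero (k f : ℝ → ℝ) (b : ℝ) : Tf k f 0 b = f b * ∫ y, k y := by
  unfold Tf
  simp [integral_const_mul]

theorem Tf_vanish (k f : ℝ → ℝ) (a : ℝ) (ha : 0 ≤ a) (hk : ∀ y, 0 ≤ y → k y = 0) (hf : ∀ t, t ≤ 0 → f t = 0) : Tf k f a 0 = 0 := by
  unfold Tf
  have : ∀ y, f (0 + a * y) * k y = 0 := by
    intro y
    rcases le_total 0 y with h | h
    · rw [hk y h, mul_zero]
    · rw [hf _ (by rw [zero_add]; exact mul_nonpos_of_nonneg_of_nonpos ha h), zero_mul]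
  simp only [this, integral_zero]

theorem core0 (i j : Fin 2) (hij : i ≠ j) (χ ρ φ d e ψ ψ' Ψ : ℝ → ℝ) (hχ : Cc χ) (hχ0 : χ 0 = 1) (hχ1 : deriv χ 0 = 0)
    (hρ : Cc ρ) (hρ1 : ∫ y, ρ y = 1) (hρ0 : ∀ y, 0 ≤ y → ρ y = 0 ∧ deriv ρ y = 0)
    (hφ : L2m φ) (hd : L2m d) (he : L2m e) (hψ : L2m ψ) (hψ' : L2m ψ')
    (h1 : ∀ t, HasDerivAt φ (d t) t) (hdc : Continuous d) (hw : IsWeakD1 univ d e)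
    (h1' : ∀ t, HasDerivAt Ψ (ψ t) t) (hψc : Continuous ψ) (hw' : IsWeakD1 univ ψ ψ')
    (zφ : ∀ t, t ≤ 0 → φ t = 0) (zd : ∀ t, t ≤ 0 → d t = 0) (zψ : ∀ t, t ≤ 0 → ψ t = 0) (zΨ : ∀ t, t ≤ 0 → Ψ t = 0) :
    ∃ ζ : E2 → ℝ, MyH52 ζ ∧ ContDiff ℝ 1 ζ ∧
      (∀ x, x i = 0 → ζ x = φ (x j) ∧ fderiv ℝ ζ x (EuclideanSpace.single i 1) = (∫ y, y * ρ y) * d (x j) + ψ (x j)) ∧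
      (∀ x, x j = 0 → 0 ≤ x i → ζ x = 0 ∧ fderiv ℝ ζ x (EuclideanSpace.single j 1) = 0) := by
  have hφc : Continuous φ := continuous_iff_continuousAt.2 fun t => (h1 t).continuousAt
  have hΨc : Continuous Ψ := continuous_iff_continuousAt.2 fun t => (h1' t).continuousAt
  have hρ' : ∫ y, y * deriv ρ y = -1 := by
    have := Tf_parts ρ (fun t => t) (fun _ => 1) hρ (fun t => hasDerivAt_id t) continuous_const 1 0
    simpa [Tf, hρ1] using this
  set ζ : E2 → ℝ := fun x => V i j χ ρ φ x + (-1) * V i j χ (deriv ρ) Ψ x with hζ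
  have D : ∀ x, HasFDerivAt ζ (((V i j (deriv χ) ρ φ x + V i j χ (fun y => y * ρ y) d x) • pr i + V i j χ ρ d x • pr j)
      + (-1 : ℝ) • ((V i j (deriv χ) (deriv ρ) Ψ x + V i j χ (fun y => y * deriv ρ y) ψ x) • pr i + V i j χ (deriv ρ) ψ x • pr j)) x :=
    fun x => (V_diffC1 i j χ ρ φ d hχ hρ h1 hdc x).add ((V_diffC1 i j χ (deriv ρ) Ψ ψ hχ hρ.deriv h1' hψc x).const_mul (-1))
  have cd : ContDiff ℝ 1 ζ := by
    rw [contDiff_one_iff_hasFDerivAt]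
    refine ⟨_, ?_, D⟩
    have c1 := V_cont i j (deriv χ) ρ φ hχ.deriv hρ hφc
    have c2 := V_cont i j χ (fun y => y * ρ y) d hχ hρ.idmul hdc
    have c3 := V_cont i j χ ρ d hχ hρ hdc
    have c4 := V_cont i j (deriv χ) (deriv ρ) Ψ hχ.deriv hρ.deriv hΨc
    have c5 := V_cont i j χ (fun y => y * deriv ρ y) ψ hχ hρ.deriv.idmul hψc
    have c6 := V_cont i j χ (deriv ρ) ψ hχ hρ.deriv hψc
    fun_prop
  refine ⟨ζ, (piece_E i j hij χ ρ φ d e hχ hρ hφ hd he h1 hdc hw).add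
    ((piece_F i j hij χ ρ Ψ ψ ψ' hχ hρ hψ hψ' h1' hψc hw').smul (-1)), cd, ?_, ?_⟩
  · intro x hx
    refine ⟨?_, ?_⟩
    · rw [hζ]
      simp only
      rw [V_parts i j χ ρ Ψ ψ hρ h1' hψc]
      simp [V, Wf, hx, Tf_zero, hχ0, hρ1]
    · rw [(D x).fderiv]
      simp [V, Wf, hx, Tf_zero, hχ0, hχ1, hρ1, hρ', hij, hij.symm]
      ring
  · intro x hx hx'
    refine ⟨?_, ?_⟩
    · rw [hζ]
      simp [V, Wf, hx, Tf_vanish ρ φ (x i) hx' (fun y hy => (hρ0 y hy).1) zφ, Tf_vanish (deriv ρ) Ψ (x i) hx' (fun y hy => (hρ0 y hy).2) zΨ]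
    · rw [(D x).fderiv]
      simp [V, Wf, hx, hij, hij.symm, Tf_vanish ρ d (x i) hx' (fun y hy => (hρ0 y hy).1) zd, Tf_vanish (deriv ρ) ψ (x i) hx' (fun y hy => (hρ0 y hy).2) zψ]

theorem IsWeakD1.lin {S : Set ℝ} {u u' v v' : ℝ → ℝ} (hu : IsWeakD1 S u u') (hv : IsWeakD1 S v v')
    (lu : LocallyIntegrableOn u S) (lu' : LocallyIntegrableOn u' S) (lv : LocallyIntegrableOn v S)
    (lv' : LocallyIntegrableOn v' S) (hS : MeasurableSet S) (c : ℝ) :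
    IsWeakD1 S (fun t => u t - c * v t) (fun t => u' t - c * v' t) := by
  intro φ h1 h2 h3
  have I : ∀ (g w : ℝ → ℝ), LocallyIntegrableOn g S → Continuous w → HasCompactSupport w → tsupport w ⊆ S →
      IntegrableOn (fun t => g t * w t) S := by
    intro g w hg hw hs hq
    have hK : IntegrableOn g (tsupport w) := hg.integrableOn_compact_subset hq hs
    have : IntegrableOn (fun t => g t * w t) (tsupport w) := hK.mul_continuousOn hw.continuousOn hs
    rw [integrableOn_iff_integrable_of_support_subset] at this
    · exact this.integrableOn
    · intro x hx
      apply subset_tsupport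
      intro h0; apply hx; simp [h0]
  have hφ1 : ContDiff ℝ 1 φ := h1.of_le (by exact_mod_cast le_top)
  have dc : Continuous (deriv φ) := hφ1.continuous_deriv (by simp)
  have ds : tsupport (deriv φ) ⊆ S := (tsupport_deriv_subset).trans h3
  have e1 := hu φ h1 h2 h3
  have e2 := hv φ h1 h2 h3
  simp_rw [sub_mul, mul_assoc]
  rw [integral_sub (I u _ lu dc h2.deriv ds) ((I v _ lv dc h2.deriv ds).const_mul c),
    integral_sub (I u' _ lu' hφ1.continuous h2 h3) ((I v' _ lv' hφ1.continuous h2 h3).const_mul c), integral_const_mul, integral_const_mul, e1, e2]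
  ring

theorem L2m.lin {u v : ℝ → ℝ} (hu : L2m u) (hv : L2m v) (c : ℝ) : L2m (fun t => u t - c * v t) :=
  ⟨hu.meas.sub (hv.meas.const_mul c), hu.lp.sub (hv.lp.const_mul c)⟩

theorem core (i j : Fin 2) (hij : i ≠ j) (φ d e ψ ψ' : ℝ → ℝ)
    (hφ : L2m φ) (hd : L2m d) (he : L2m e) (hψ : L2m ψ) (hψ' : L2m ψ')
    (h1 : ∀ t, HasDerivAt φ (d t) t) (hdc : Continuous d) (hw : IsWeakD1 univ d e)
    (hψc : Continuous ψ) (hw' : IsWeakD1 univ ψ ψ')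
    (zφ : ∀ t, t ≤ 0 → φ t = 0) (zd : ∀ t, t ≤ 0 → d t = 0) (zψ : ∀ t, t ≤ 0 → ψ t = 0) :
    ∃ ζ : E2 → ℝ, MyH52 ζ ∧ ContDiff ℝ 1 ζ ∧
      (∀ x, x i = 0 → ζ x = φ (x j) ∧ fderiv ℝ ζ x (EuclideanSpace.single i 1) = ψ (x j)) ∧
      (∀ x, x j = 0 → 0 ≤ x i → ζ x = 0 ∧ fderiv ℝ ζ x (EuclideanSpace.single j 1) = 0) := by
  obtain ⟨χ, hχ, hχ0, hχ1⟩ := exists_chi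
  obtain ⟨ρ, hρ, hρ1, hρ0⟩ := exists_rho
  set c := ∫ y, y * ρ y with hcdef
  have hc : Continuous (fun t => ψ t - c * d t) := by fun_prop
  have zz : ∀ t, t ≤ 0 → ψ t - c * d t = 0 := fun t ht => by simp [zψ t ht, zd t ht]
  have L : ∀ {g}, L2m g → LocallyIntegrableOn g univ := fun h => h.loc.locallyIntegrableOn _
  have zΨ : ∀ t, t ≤ 0 → ∫ s in (0:ℝ)..t, (ψ s - c * d s) = 0 := by
    intro t ht
    have := intervalIntegral.integral_congr (μ := volume) (a := 0) (b := t) (f := fun s => ψ s - c * d s) (g := fun _ => 0) (by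
      intro s hs
      rw [uIcc_of_ge ht] at hs
      exact zz s hs.2)
    simpa using this
  obtain ⟨ζ, a1, a2, a3, a4⟩ := core0 i j hij χ ρ φ d e (fun t => ψ t - c * d t) (fun t => ψ' t - c * e t)
    (fun t => ∫ s in (0:ℝ)..t, (ψ s - c * d s)) hχ hχ0 hχ1 hρ hρ1 hρ0 hφ hd he (hψ.lin hd c) (hψ'.lin he c) h1 hdc hw
    (fun t => intervalIntegral.integral_hasDerivAt_right (hc.intervalIntegrable _ _) (hc.stronglyMeasurableAtFilter _ _) hc.continuousAt)
    hc (hw'.lin hw (L hψ) (L hψ') (L hd) (L he) MeasurableSet.univ c) zφ zd zz zΨ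
  · refine ⟨ζ, a1, a2, fun x hx => ⟨(a3 x hx).1, ?_⟩, a4⟩
    rw [(a3 x hx).2, ← hcdef]; ring

end part12

section part13
open scoped RealInnerProductSpace FourierTransform

theorem exists_theta : ∃ θ : ℝ → ℝ, ContDiff ℝ (⊤ : ℕ∞) θ ∧ (∀ t, t ≤ 1 → θ t = 0) ∧ (∀ t, 2 ≤ t → θ t = 1) ∧
    (∀ t, |θ t| ≤ 1) ∧ Cc (deriv θ) := by
  have h1 : ContDiff ℝ (⊤ : ℕ∞) (fun t : ℝ => smoothTransition (t - 1)) := Real.smoothTransition.contDiff.comp (by fun_prop)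
  refine ⟨fun t => smoothTransition (t - 1), h1, ?_, ?_, ?_, ?_, ?_⟩
  · intro t ht; exact smoothTransition.zero_of_nonpos (by linarith)
  · intro t ht; exact smoothTransition.one_of_one_le (by linarith)
  · intro t
    rw [abs_of_nonneg (smoothTransition.nonneg _)]
    exact smoothTransition.le_one _
  · exact (contDiff_infty_iff_deriv.1 h1).2
  · apply HasCompactSupport.intro (K := Icc 1 2) isCompact_Icc
    intro t ht
    rcases lt_or_ge t 1 with h | h
    · have : (fun t : ℝ => smoothTransition (t - 1)) =ᶠ[nhds t] fun _ => 0 := by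
        filter_upwards [gt_mem_nhds h] with s hs using smoothTransition.zero_of_nonpos (by linarith)
      rw [this.deriv_eq]; simp
    · have h2 : 2 < t := by by_contra h'; exact ht ⟨h, not_lt.1 h'⟩
      have : (fun t : ℝ => smoothTransition (t - 1)) =ᶠ[nhds t] fun _ => 1 := by
        filter_upwards [lt_mem_nhds h2] with s hs using smoothTransition.one_of_one_le (by linarith)
      rw [this.deriv_eq]; simp

theorem int_mul_Cc {S : Set ℝ} {g w : ℝ → ℝ} (hg : MemLp g 2 (volume.restrict S)) (hw : Continuous w) (hs : HasCompactSupport w) :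
    IntegrableOn (fun t => g t * w t) S :=
  MemLp.integrable_mul (p := 2) (q := 2) hg ((hw.memLp_of_hasCompactSupport hs).mono_measure Measure.restrict_le_self)

/-- extension by zero preserves the weak derivative -/
theorem weak_ext (g g' : ℝ → ℝ) (hg : MemLp g 2 (volume.restrict (Ioi 0))) (hg' : MemLp g' 2 (volume.restrict (Ioi 0)))
    (hc : ContinuousOn g (Ici 0)) (h0 : g 0 = 0) (hw : IsWeakD1 (Ioi 0) g g') :
    IsWeakD1 univ ((Ioi (0:ℝ)).indicator g) ((Ioi (0:ℝ)).indicator g') := by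
  intro η η1 η2 _
  obtain ⟨θ, θ1, θ2, θ3, θ4, θ5⟩ := exists_theta
  have hη1 : ContDiff ℝ 1 η := η1.of_le (by exact_mod_cast le_top)
  have ηc : Continuous η := hη1.continuous
  have η'c : Continuous (deriv η) := hη1.continuous_deriv (by simp)
  have θd : ∀ t, HasDerivAt θ (deriv θ t) t := fun t => ((θ1.differentiable (by simp)) t).hasDerivAt
  have ηd : ∀ t, HasDerivAt η (deriv η t) t := fun t => ((η1.differentiable (by simp)) t).hasDerivAt
  have red : ∀ (g w : ℝ → ℝ), ∫ t in univ, (Ioi (0:ℝ)).indicator g t * w t = ∫ t in Ioi 0, g t * w t := by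
    intro g w
    rw [Measure.restrict_univ, ← integral_indicator measurableSet_Ioi]
    congr 1; ext t
    by_cases h : t ∈ Ioi (0:ℝ) <;> simp [h]
  rw [red, red]
  -- the cut-off identity
  have N : ∀ n : ℕ, (n + 1 : ℝ) ≠ 0 := fun n => by positivity
  have id1 : ∀ n : ℕ, (∫ s in Ioi 0, g ((n+1:ℝ)⁻¹ * s) * (deriv θ s * η ((n+1:ℝ)⁻¹ * s))) +
      ∫ t in Ioi 0, g t * (θ ((n+1) * t) * deriv η t) = - ∫ t in Ioi 0, g' t * (θ ((n+1) * t) * η t) := by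
    intro n
    set a : ℝ := n + 1 with ha
    have ap : 0 < a := by positivity
    have sc := integral_comp_mul_left_Ioi (fun t => g t * (deriv θ (a * t) * η t)) 0 (inv_pos.2 ap)
    simp only [mul_zero, inv_inv, smul_eq_mul, mul_inv_cancel_left₀ ap.ne'] at sc
    rw [sc, ← integral_const_mul]
    have ts : tsupport (fun t => θ (a * t) * η t) ⊆ Ioi 0 := by
      have : tsupport (fun t => θ (a * t) * η t) ⊆ Ici a⁻¹ := by
        apply closure_minimal _ isClosed_Ici
        intro t ht
        by_contra h
        apply ht
        have h' : t < a⁻¹ := not_le.1 h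
        have : a * t ≤ 1 := by
          have := mul_lt_mul_of_pos_left h' ap
          rw [mul_inv_cancel₀ ap.ne'] at this
          exact this.le
        simp [θ2 _ this]
      exact this.trans (fun t ht => lt_of_lt_of_le (inv_pos.2 ap) ht)
    have dd : deriv (fun t => θ (a * t) * η t) = fun t => a * deriv θ (a * t) * η t + θ (a * t) * deriv η t := by
      ext t
      have h1 : HasDerivAt (fun t => a * t) (a * 1) t := (hasDerivAt_id t).const_mul a
      have := (((θd (a * t)).comp t h1).mul (ηd t)).deriv
      refine this.trans ?_
      simp only [Function.comp]; ring
    have k := hw (fun t => θ (a * t) * η t) ((θ1.comp (by fun_prop)).mul η1) η2.mul_left ts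
    rw [dd] at k
    rw [← k, ← integral_add]
    · congr 1; ext t; ring
    · have := int_mul_Cc (S := Ioi 0) (w := fun t => a * deriv θ (a * t) * η t) hg (by have := θ5.smooth.continuous; fun_prop) η2.mul_left
      refine this.congr_fun (fun t _ => ?_) measurableSet_Ioi
      simp only; ring
    · exact int_mul_Cc hg (by have := θ1.continuous; fun_prop) η2.deriv.mul_left
  have lim : ∀ (f w : ℝ → ℝ), MemLp f 2 (volume.restrict (Ioi 0)) → Continuous w → HasCompactSupport w →
      Filter.Tendsto (fun n : ℕ => ∫ t in Ioi 0, f t * (θ ((n+1) * t) * w t)) Filter.atTop (nhds (∫ t in Ioi 0, f t * w t)) := by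
    intro f w hf hwc hws
    refine tendsto_integral_of_dominated_convergence (fun t => ‖f t * w t‖) ?_ (int_mul_Cc hf hwc hws).norm ?_ ?_
    · intro n
      exact (int_mul_Cc (w := fun t => θ ((n+1) * t) * w t) hf (by have := θ1.continuous; fun_prop) hws.mul_left).1
    · intro n
      filter_upwards with t
      rw [norm_mul, norm_mul, norm_mul]
      have := θ4 ((n+1)*t)
      rw [← Real.norm_eq_abs] at this
      have h2 : ‖θ ((n+1) * t)‖ * ‖w t‖ ≤ ‖w t‖ := mul_le_of_le_one_left (norm_nonneg _) this
      exact mul_le_mul_of_nonneg_left h2 (norm_nonneg _)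
    · filter_upwards [ae_restrict_mem measurableSet_Ioi] with t ht
      apply tendsto_const_nhds.congr'
      obtain ⟨n0, hn0⟩ := exists_nat_gt (2 / t)
      filter_upwards [Filter.eventually_ge_atTop n0] with n hn
      have ht' : 0 < t := ht
      rw [θ3, one_mul]
      rw [div_lt_iff₀ ht'] at hn0
      have : (n0:ℝ) ≤ n := by exact_mod_cast hn
      nlinarith
  have lim0 : Filter.Tendsto (fun n : ℕ => ∫ s in Ioi 0, g ((n+1:ℝ)⁻¹ * s) * (deriv θ s * η ((n+1:ℝ)⁻¹ * s))) Filter.atTop (nhds 0) := by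
    obtain ⟨M, hM⟩ := isCompact_Icc.exists_bound_of_continuousOn (hc.mono (Icc_subset_Ici_self : Icc (0:ℝ) 2 ⊆ Ici 0))
    obtain ⟨C, hC⟩ := η2.exists_bound_of_continuous ηc
    have z : (0:ℝ) = ∫ s in Ioi (0:ℝ), (0:ℝ) := by simp
    have i0 : ∀ n : ℕ, (0:ℝ) < (n+1:ℝ)⁻¹ := fun n => by positivity
    have t0 : Filter.Tendsto (fun n : ℕ => (n+1:ℝ)⁻¹) Filter.atTop (nhds 0) := by
      simpa [one_div] using tendsto_one_div_add_atTop_nhds_zero_nat (𝕜 := ℝ)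
    have tz : ∀ s, 2 < s → deriv θ s = 0 := by
      intro s hs
      have : θ =ᶠ[nhds s] fun _ => 1 := by
        filter_upwards [lt_mem_nhds hs] with r hr using θ3 r hr.le
      rw [this.deriv_eq]; simp
    suffices Filter.Tendsto (fun n : ℕ => ∫ s in Ioi 0, g ((n+1:ℝ)⁻¹ * s) * (deriv θ s * η ((n+1:ℝ)⁻¹ * s))) Filter.atTop
        (nhds (∫ s in Ioi (0:ℝ), (0:ℝ))) by rwa [← z] at this
    refine tendsto_integral_of_dominated_convergence (fun s => M * (‖deriv θ s‖ * C)) ?_ ?_ ?_ ?_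
    · intro n
      have gc : ContinuousOn (fun s => g ((n+1:ℝ)⁻¹ * s)) (Ioi 0) :=
        hc.comp (by fun_prop) (fun s hs => (mul_pos (i0 n) hs).le)
      have := θ5.smooth.continuous
      exact (gc.mul (Continuous.continuousOn (by fun_prop))).aestronglyMeasurable measurableSet_Ioi
    · have : Integrable (deriv θ) := θ5.smooth.continuous.integrable_of_hasCompactSupport θ5.supp
      exact ((this.norm.mul_const C).const_mul M).integrableOn
    · intro n
      filter_upwards [ae_restrict_mem measurableSet_Ioi] with s hs
      have hs' : 0 < s := hs
      rw [norm_mul, norm_mul]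
      rcases le_or_gt s 2 with h | h
      · have in1 : (n+1:ℝ)⁻¹ ≤ 1 := inv_le_one_of_one_le₀ (by simp)
        have b1 := hM ((n+1:ℝ)⁻¹ * s) ⟨by have := i0 n; positivity, by nlinarith⟩
        have b2 := hC ((n+1:ℝ)⁻¹ * s)
        have := (norm_nonneg _).trans b1
        gcongr
      · simp [tz s h]
    · filter_upwards [ae_restrict_mem measurableSet_Ioi] with s hs
      have hs' : 0 < s := hs
      have t1 : Filter.Tendsto (fun n : ℕ => (n+1:ℝ)⁻¹ * s) Filter.atTop (nhds 0) := by simpa using t0.mul_const s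
      have t2 : Filter.Tendsto (fun n : ℕ => g ((n+1:ℝ)⁻¹ * s)) Filter.atTop (nhds 0) := by
        have := (hc 0 self_mem_Ici).tendsto
        rw [h0] at this
        apply this.comp
        rw [tendsto_nhdsWithin_iff]
        exact ⟨t1, Filter.Eventually.of_forall fun n => (mul_pos (i0 n) hs').le⟩
      have t3 : Filter.Tendsto (fun n : ℕ => η ((n+1:ℝ)⁻¹ * s)) Filter.atTop (nhds (η 0)) := (ηc.tendsto 0).comp t1
      simpa using t2.mul (t3.const_mul (deriv θ s))
  have L := lim0.add (lim g (deriv η) hg η'c η2.deriv)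
  simp_rw [id1] at L
  rw [zero_add] at L
  exact tendsto_nhds_unique L (lim g' η hg' ηc η2).neg

theorem weak_classical (S : Set ℝ) (f f' : ℝ → ℝ) (h : ∀ t ∈ S, HasDerivAt f (f' t) t) (hc : ContinuousOn f S) (hc' : ContinuousOn f' S)
     : IsWeakD1 S f f' := by
  intro η η1 η2 η3
  have hη1 : ContDiff ℝ 1 η := η1.of_le (by exact_mod_cast le_top)
  have ηc : Continuous η := hη1.continuous
  have η'c : Continuous (deriv η) := hη1.continuous_deriv (by simp)
  have dts : tsupport (deriv η) ⊆ tsupport η := tsupport_deriv_subset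
  have I : ∀ (g w : ℝ → ℝ), ContinuousOn g S → Continuous w → HasCompactSupport w → tsupport w ⊆ S →
      Integrable (fun t => g t * w t) := by
    intro g w hg hw hs hq
    have hK : IntegrableOn g (tsupport w) := (hg.mono hq).integrableOn_compact hs
    have : IntegrableOn (fun t => g t * w t) (tsupport w) := hK.mul_continuousOn hw.continuousOn hs
    rwa [integrableOn_iff_integrable_of_support_subset] at this
    intro x hx
    apply subset_tsupport
    intro h0; apply hx; simp [h0]
  have z1 : ∀ x, x ∉ S → η x = 0 := fun x hx => image_eq_zero_of_notMem_tsupport fun h => hx (η3 h)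
  have z2 : ∀ x, x ∉ S → deriv η x = 0 := fun x hx => image_eq_zero_of_notMem_tsupport fun h => hx (η3 (dts h))
  rw [setIntegral_eq_integral_of_forall_compl_eq_zero (fun x hx => by rw [z2 x hx, mul_zero]),
    setIntegral_eq_integral_of_forall_compl_eq_zero (fun x hx => by rw [z1 x hx, mul_zero])]
  exact integral_mul_deriv_eq_deriv_mul_of_integrable (u := f) (v := η) (fun x hx => h x (η3 hx))
    (fun x _ => (hη1.differentiable (by simp) x).hasDerivAt) (I _ _ hc η'c η2.deriv (dts.trans η3)) (I _ _ hc' ηc η2 η3) (I _ _ hc ηc η2 η3)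

theorem weak_unique (S : Set ℝ) (hS : IsOpen S) (f u v : ℝ → ℝ) (hu : IsWeakD1 S f u) (hv : IsWeakD1 S f v)
    (lu : LocallyIntegrableOn u S) (lv : LocallyIntegrableOn v S) : u =ᵐ[volume.restrict S] v := by
  have key := hS.ae_eq_zero_of_integral_contDiff_smul_eq_zero (μ := volume) (f := fun t => u t - v t) (lu.sub lv) ?_
  · rw [Filter.EventuallyEq, ae_restrict_iff' hS.measurableSet]
    filter_upwards [key] with t ht hts
    exact sub_eq_zero.1 (ht hts)
  · intro η η1 η2 η3
    have ηc := η1.continuous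
    have I : ∀ (g : ℝ → ℝ), LocallyIntegrableOn g S → IntegrableOn (fun t => g t * η t) S := by
      intro g hg
      have hK : IntegrableOn g (tsupport η) := hg.integrableOn_compact_subset η3 η2
      have : IntegrableOn (fun t => g t * η t) (tsupport η) := hK.mul_continuousOn ηc.continuousOn η2
      rw [integrableOn_iff_integrable_of_support_subset] at this
      · exact this.integrableOn
      · intro x hx
        apply subset_tsupport
        intro h0; apply hx; simp [h0]
    have e1 := hu η η1 η2 η3
    have e2 := hv η η1 η2 η3
    rw [e1, neg_inj] at e2
    have z1 : ∀ x, x ∉ S → η x = 0 := fun x hx => image_eq_zero_of_notMem_tsupport fun h => hx (η3 h)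
    rw [← setIntegral_eq_integral_of_forall_compl_eq_zero (s := S) (fun x hx => by rw [z1 x hx, zero_smul])]
    have : ∀ t, η t • (u t - v t) = u t * η t - v t * η t := fun t => by rw [smul_eq_mul]; ring
    simp_rw [this]
    rw [integral_sub (I u lu) (I v lv), e2, sub_self]

theorem weak_congr {S : Set ℝ} {u u' v v' : ℝ → ℝ} (h : IsWeakD1 S u v) (hu : u =ᵐ[volume.restrict S] u')
    (hv : v =ᵐ[volume.restrict S] v') : IsWeakD1 S u' v' := by
  intro η η1 η2 η3
  have e1 : ∫ t in S, u t * deriv η t = ∫ t in S, u' t * deriv η t :=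
    integral_congr_ae (hu.mul (Filter.EventuallyEq.refl _ (deriv η)))
  have e2 : ∫ t in S, v t * η t = ∫ t in S, v' t * η t := integral_congr_ae (hv.mul (Filter.EventuallyEq.refl _ η))
  rw [← e1, ← e2]
  exact h η η1 η2 η3

end part13

section part14
open scoped RealInnerProductSpace FourierTransform

theorem ind_max (g : ℝ → ℝ) (h0 : g 0 = 0) : (Ioi (0:ℝ)).indicator g = fun t => g (max t 0) := by
  ext t
  rcases le_or_gt t 0 with h | h
  · rw [indicator_of_notMem (by simpa using h), max_eq_right h, h0]
  · rw [indicator_of_mem (show t ∈ Ioi (0:ℝ) from h), max_eq_left h.le]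

theorem ind_cont (g : ℝ → ℝ) (h0 : g 0 = 0) (hc : ContinuousOn g (Ici 0)) : Continuous ((Ioi (0:ℝ)).indicator g) := by
  rw [ind_max g h0]
  exact hc.comp_continuous (by fun_prop) (fun t => mem_Ici.2 (le_max_right _ _))

theorem ind_lp (g : ℝ → ℝ) (h : MemLp g 2 (volume.restrict (Ioi (0:ℝ)))) : MemLp ((Ioi (0:ℝ)).indicator g) 2 :=
  (memLp_indicator_iff_restrict measurableSet_Ioi).2 h

theorem meas_rep (g : ℝ → ℝ) (h : MemLp g 2) : ∃ e, L2m e ∧ g =ᵐ[volume] e := by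
  refine ⟨h.1.mk g, ⟨h.1.stronglyMeasurable_mk.measurable, (memLp_congr_ae h.1.ae_eq_mk).1 h⟩, h.1.ae_eq_mk⟩

theorem half1 (ψ ψ1 : ℝ → ℝ) (h : MemH1halfline ψ ψ1) (hc : ContinuousOn ψ (Ici 0)) (h0 : ψ 0 = 0) :
    ∃ f e, L2m f ∧ L2m e ∧ Continuous f ∧ IsWeakD1 univ f e ∧ (∀ t, t ≤ 0 → f t = 0) ∧ ∀ t, 0 ≤ t → f t = ψ t := by
  obtain ⟨a1, a2, a3⟩ := h
  obtain ⟨e, he, hee⟩ := meas_rep _ (ind_lp _ a2)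
  have c := ind_cont ψ h0 hc
  refine ⟨_, e, ⟨c.measurable, ind_lp ψ a1⟩, he, c, ?_, ?_, ?_⟩
  · exact weak_congr (weak_ext ψ ψ1 a1 a2 hc h0 a3) (Filter.EventuallyEq.refl _ _) (by simpa using hee)
  · intro t ht
    exact indicator_of_notMem (by simpa using ht) _
  · intro t ht
    simp only [ind_max ψ h0, max_eq_left ht]

theorem half2 (φ φ1 φ2 : ℝ → ℝ) (h : MemH2halfline φ φ1 φ2) (hc : ContDiffOn ℝ 1 φ (Ici 0)) (h0 : φ 0 = 0)
    (h1 : derivWithin φ (Ici 0) 0 = 0) :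
    ∃ f d e, L2m f ∧ L2m d ∧ L2m e ∧ (∀ t, HasDerivAt f (d t) t) ∧ Continuous d ∧ IsWeakD1 univ d e ∧
      (∀ t, t ≤ 0 → f t = 0) ∧ (∀ t, t ≤ 0 → d t = 0) ∧ ∀ t, 0 ≤ t → f t = φ t := by
  obtain ⟨a1, a2, a3, a4, a5⟩ := h
  set D := derivWithin φ (Ici 0) with hD
  have Dc : ContinuousOn D (Ici 0) := hc.continuousOn_derivWithin (uniqueDiffOn_Ici 0) le_rfl
  have hdw : ∀ t, 0 ≤ t → HasDerivWithinAt φ (D t) (Ici 0) t := fun t ht =>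
    (hc.differentiableOn (by simp) t ht).hasDerivWithinAt
  have hd : ∀ t ∈ Ioi (0:ℝ), HasDerivAt φ (D t) t := fun t ht => (hdw t (le_of_lt ht)).hasDerivAt (Ici_mem_nhds ht)
  have Dl : LocallyIntegrableOn D (Ioi 0) := (Dc.mono Ioi_subset_Ici_self).locallyIntegrableOn measurableSet_Ioi
  have φ1l : LocallyIntegrableOn φ1 (Ioi 0) := by
    have := a2.locallyIntegrable (by norm_num)
    exact locallyIntegrableOn_of_locallyIntegrable_restrict this
  have ae : φ1 =ᵐ[volume.restrict (Ioi 0)] D := weak_unique _ isOpen_Ioi φ φ1 D a4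
    (weak_classical _ φ D hd (hc.continuousOn.mono Ioi_subset_Ici_self) (Dc.mono Ioi_subset_Ici_self)) φ1l Dl
  have D2 : MemLp D 2 (volume.restrict (Ioi 0)) := (memLp_congr_ae ae).1 a2
  have H1 : MemH1halfline D φ2 := ⟨D2, a3, weak_congr a5 ae (Filter.EventuallyEq.refl _ _)⟩
  obtain ⟨d, e, b1, b2, b3, b4, b5, b6⟩ := half1 D φ2 H1 Dc h1
  have key : ∀ t, HasDerivAt ((Ioi (0:ℝ)).indicator φ) (d t) t := by
    intro t
    have zl : ∀ s, s ≤ 0 → (Ioi (0:ℝ)).indicator φ s = 0 := fun s hs => indicator_of_notMem (by simpa using hs) _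
    have zr : ∀ s, 0 ≤ s → (Ioi (0:ℝ)).indicator φ s = φ s := fun s hs => by simp only [ind_max φ h0, max_eq_left hs]
    rcases lt_trichotomy t 0 with h | h | h
    · rw [b5 t h.le]
      refine (hasDerivAt_const t (0:ℝ)).congr_of_eventuallyEq ?_
      filter_upwards [gt_mem_nhds h] with s hs using zl s hs.le
    · subst h
      rw [b5 0 le_rfl]
      have l : HasDerivWithinAt ((Ioi (0:ℝ)).indicator φ) 0 (Iic 0) 0 :=
        (hasDerivWithinAt_const 0 _ (0:ℝ)).congr (fun s hs => zl s hs) (zl 0 le_rfl)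
      have r : HasDerivWithinAt ((Ioi (0:ℝ)).indicator φ) 0 (Ici 0) 0 := by
        have := hdw 0 le_rfl
        rw [h1] at this
        exact this.congr (fun s hs => zr s hs) (zr 0 le_rfl)
      have := l.union r
      rwa [Iic_union_Ici, hasDerivWithinAt_univ] at this
    · rw [b6 t h.le]
      refine (hd t h).congr_of_eventuallyEq ?_
      filter_upwards [lt_mem_nhds h] with s hs using zr s hs.le
  have fc : Continuous ((Ioi (0:ℝ)).indicator φ) := ind_cont φ h0 hc.continuousOn
  refine ⟨_, d, e, ⟨fc.measurable, ind_lp φ a1⟩, b1, b2, key, b3, b4, ?_, b5, ?_⟩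
  · intro t ht
    exact indicator_of_notMem (by simpa using ht) _
  · intro t ht
    simp only [ind_max φ h0, max_eq_left ht]

theorem Cc.lp {k : ℝ → ℝ} (hk : Cc k) (S : Set ℝ) : MemLp k 2 (volume.restrict S) :=
  (hk.smooth.continuous.memLp_of_hasCompactSupport hk.supp).mono_measure Measure.restrict_le_self

theorem lp_locOn {g : ℝ → ℝ} {S : Set ℝ} (h : MemLp g 2 (volume.restrict S)) : LocallyIntegrableOn g S :=
  locallyIntegrableOn_of_locallyIntegrable_restrict (h.locallyIntegrable (by norm_num))

theorem weak_sub {u u' P : ℝ → ℝ} (h : IsWeakD1 (Ioi 0) u u') (hu : MemLp u 2 (volume.restrict (Ioi 0)))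
    (hu' : MemLp u' 2 (volume.restrict (Ioi 0))) (hP : Cc P) : IsWeakD1 (Ioi 0) (fun t => u t - P t) (fun t => u' t - deriv P t) := by
  have := h.lin (weak_classical (Ioi 0) P (deriv P) (fun t _ => hP.hasDerivAt t) hP.smooth.continuous.continuousOn
    hP.deriv.smooth.continuous.continuousOn) (lp_locOn hu) (lp_locOn hu') (lp_locOn (hP.lp _)) (lp_locOn (hP.deriv.lp _)) measurableSet_Ioi 1
  simpa using this

theorem H1_sub {u u' P : ℝ → ℝ} (h : MemH1halfline u u') (hP : Cc P) : MemH1halfline (fun t => u t - P t) (fun t => u' t - deriv P t) :=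
  ⟨h.1.sub (hP.lp _), h.2.1.sub (hP.deriv.lp _), weak_sub h.2.2 h.1 h.2.1 hP⟩

theorem H2_sub {u u' u'' P : ℝ → ℝ} (h : MemH2halfline u u' u'') (hP : Cc P) :
    MemH2halfline (fun t => u t - P t) (fun t => u' t - deriv P t) (fun t => u'' t - deriv (deriv P) t) :=
  ⟨h.1.sub (hP.lp _), h.2.1.sub (hP.deriv.lp _), h.2.2.1.sub (hP.deriv.deriv.lp _), weak_sub h.2.2.2.1 h.1 h.2.1 hP,
    weak_sub h.2.2.2.2 h.2.1 h.2.2.1 hP.deriv⟩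

/-- core lemma with half-line data, after subtraction of smooth functions -/
theorem core_half (i j : Fin 2) (hij : i ≠ j) (φ φ1 φ2 ψ ψ1 P Q : ℝ → ℝ) (h : MemH2halfline φ φ1 φ2) (h' : MemH1halfline ψ ψ1)
    (hc : ContDiffOn ℝ 1 φ (Ici 0)) (hc' : ContinuousOn ψ (Ici 0)) (hP : Cc P) (hQ : Cc Q)
    (e1 : P 0 = φ 0) (e2 : deriv P 0 = derivWithin φ (Ici 0) 0) (e3 : Q 0 = ψ 0) :
    ∃ ζ : E2 → ℝ, MyH52 ζ ∧ ContDiff ℝ 1 ζ ∧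
      (∀ x, x i = 0 → 0 ≤ x j → ζ x = φ (x j) - P (x j) ∧ fderiv ℝ ζ x (EuclideanSpace.single i 1) = ψ (x j) - Q (x j)) ∧
      (∀ x, x j = 0 → 0 ≤ x i → ζ x = 0 ∧ fderiv ℝ ζ x (EuclideanSpace.single j 1) = 0) := by
  have hP1 : ContDiff ℝ 1 P := hP.smooth.of_le (by exact_mod_cast le_top)
  have hd0 : derivWithin (fun t => φ t - P t) (Ici 0) 0 = 0 := by
    have a := (hc.differentiableOn (by simp) 0 self_mem_Ici).hasDerivWithinAt
    have := (a.sub (hP.hasDerivAt 0).hasDerivWithinAt).derivWithin (uniqueDiffOn_Ici 0 0 self_mem_Ici)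
    refine this.trans ?_
    rw [e2, sub_self]
  obtain ⟨f, d, e, a1, a2, a3, a4, a5, a6, a7, a8, a9⟩ := half2 _ _ _ (H2_sub h hP) (hc.sub hP1.contDiffOn) (by simp [e1]) hd0
  obtain ⟨p, q, b1, b2, b3, b4, b5, b6⟩ := half1 _ _ (H1_sub h' hQ) (hc'.sub hQ.smooth.continuous.continuousOn) (by simp [e3])
  obtain ⟨ζ, c1, c2, c3, c4⟩ := core i j hij f d e p q a1 a2 a3 b1 b2 a4 a5 a6 b3 b4 a7 a8 b5
  refine ⟨ζ, c1, c2, fun x hx hx' => ?_, c4⟩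
  rw [(c3 x hx).1, (c3 x hx).2, a9 _ hx', b6 _ hx']
  exact ⟨rfl, rfl⟩

theorem tensor_diff {a b : ℝ → ℝ} (ha : Cc a) (hb : Cc b) (x : E2) : HasFDerivAt (fun x : E2 => a (x 0) * b (x 1))
      ((deriv a (x 0) * b (x 1)) • pr 0 + (a (x 0) * deriv b (x 1)) • pr 1) x := by
  have h3 : HasFDerivAt (fun x : E2 => a (x 0)) (deriv a (x 0) • pr 0) x :=
    (ha.hasDerivAt (x 0)).comp_hasFDerivAt x (pr 0).hasFDerivAt
  have h4 : HasFDerivAt (fun x : E2 => b (x 1)) (deriv b (x 1) • pr 1) x :=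
    (hb.hasDerivAt (x 1)).comp_hasFDerivAt x (pr 1).hasFDerivAt
  refine (h3.mul h4).congr_fderiv ?_
  module

theorem tensor_C1 {a b : ℝ → ℝ} (ha : Cc a) (hb : Cc b) : ContDiff ℝ 1 (fun x : E2 => a (x 0) * b (x 1)) := by
  have ha1 : ContDiff ℝ 1 a := ha.smooth.of_le (by exact_mod_cast le_top)
  have hb1 : ContDiff ℝ 1 b := hb.smooth.of_le (by exact_mod_cast le_top)
  exact (ha1.comp (pr 0).contDiff).mul (hb1.comp (pr 1).contDiff)

theorem corner (A B C : ℝ) (χ : ℝ → ℝ) (hχ : Cc χ) (hχ0 : χ 0 = 1) (hχ1 : deriv χ 0 = 0) :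
    ∃ ζ : E2 → ℝ, MyH52 ζ ∧ ContDiff ℝ 1 ζ ∧
      (∀ x, x 0 = 0 → ζ x = A * χ (x 1) + C * (x 1 * χ (x 1)) ∧ fderiv ℝ ζ x (EuclideanSpace.single 0 1) = B * χ (x 1)) ∧
      (∀ x, x 1 = 0 → ζ x = A * χ (x 0) + B * (x 0 * χ (x 0)) ∧ fderiv ℝ ζ x (EuclideanSpace.single 1 1) = C * χ (x 0)) := by
  have hi := hχ.idmul
  have d1 : deriv (fun y => y * χ y) 0 = 1 := by
    have := ((hasDerivAt_id (0:ℝ)).mul (hχ.hasDerivAt 0)).deriv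
    refine this.trans ?_
    simp [hχ0]
  have T : ∀ {a b}, Cc a → Cc b → MyH52 (fun x => a (x 0) * b (x 1)) := fun ha hb => piece_T 0 1 (by simp) _ _ ha hb
  refine ⟨fun x => (A * (χ (x 0) * χ (x 1)) + B * ((x 0 * χ (x 0)) * χ (x 1))) + C * (χ (x 0) * (x 1 * χ (x 1))),
    (((T hχ hχ).smul A).add ((T hi hχ).smul B)).add ((T hχ hi).smul C),
    ((contDiff_const.mul (tensor_C1 hχ hχ)).add (contDiff_const.mul (tensor_C1 hi hχ))).add (contDiff_const.mul (tensor_C1 hχ hi)), ?_, ?_⟩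
  all_goals
    intro x hx
    have D := (((tensor_diff hχ hχ x).const_mul A).add ((tensor_diff hi hχ x).const_mul B)).add ((tensor_diff hχ hi x).const_mul C)
    refine ⟨by simp [hx, hχ0], ?_⟩
    refine (congrArg (fun L : E2 →L[ℝ] ℝ => L _) D.fderiv).trans ?_
    simp [hx, hχ0, hχ1, d1]

theorem mem_clos (x : E2) (h0 : 0 ≤ x 0) (h1 : 0 ≤ x 1) : x ∈ closure quadrant := by
  have t : Filter.Tendsto (fun ε : ℝ => x + ε • (stdb2 0 + stdb2 1)) (nhdsWithin 0 (Ioi 0)) (nhds x) := by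
    have : Continuous (fun ε : ℝ => x + ε • (stdb2 0 + stdb2 1)) := by fun_prop
    have := this.tendsto 0
    simp only [zero_smul, add_zero] at this
    exact this.mono_left nhdsWithin_le_nhds
  refine mem_closure_of_tendsto t ?_
  filter_upwards [self_mem_nhdsWithin] with ε hε
  have : 0 < ε := hε
  constructor
  · simp [stdb2]; linarith
  · simp [stdb2]; linarith

theorem fdw (ζ : E2 → ℝ) (h : ContDiff ℝ 1 ζ) (x : E2) (h0 : 0 ≤ x 0) (h1 : 0 ≤ x 1) :
    fderivWithin ℝ ζ (closure quadrant) x = fderiv ℝ ζ x := by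
  have op : IsOpen quadrant := by
    have a : IsOpen {x : E2 | 0 < x 0} := isOpen_lt continuous_const (by fun_prop)
    have b : IsOpen {x : E2 | 0 < x 1} := isOpen_lt continuous_const (by fun_prop)
    exact a.inter b
  have cv : Convex ℝ quadrant := by
    intro u hu v hv a b ha hb hab
    rcases ha.eq_or_lt with rfl | ha
    · have : b = 1 := by linarith
      subst this; simpa using hv
    · constructor
      · have := mul_pos ha hu.1; have := mul_nonneg hb hv.1.le; simp; linarith
      · have := mul_pos ha hu.2; have := mul_nonneg hb hv.2.le; simp; linarith
  have ud : UniqueDiffOn ℝ (closure quadrant) := by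
    apply uniqueDiffOn_convex cv.closure
    refine ⟨stdb2 0 + stdb2 1, interior_mono subset_closure ?_⟩
    rw [op.interior_eq]
    constructor <;> simp [stdb2]
  exact fderivWithin_eq_fderiv (ud x (mem_clos x h0 h1)) (h.differentiable (by simp) x)

theorem quadrant_inverse_trace_aux
    (φ₁ ψ₁ φ₂ ψ₂ : ℝ → ℝ) (φ₁' φ₁'' φ₂' φ₂'' ψ₁' ψ₂' : ℝ → ℝ)
    (h₁ : MemH2halfline φ₁ φ₁' φ₁'') (h₂ : MemH2halfline φ₂ φ₂' φ₂'')
    (h₁' : MemH1halfline ψ₁ ψ₁') (h₂' : MemH1halfline ψ₂ ψ₂')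
    (hc₁ : ContDiffOn ℝ 1 φ₁ (Ici 0)) (hc₂ : ContDiffOn ℝ 1 φ₂ (Ici 0))
    (hd₁ : ContinuousOn ψ₁ (Ici 0)) (hd₂ : ContinuousOn ψ₂ (Ici 0))
    (hcpt₁ : φ₁ 0 = φ₂ 0)
    (hcpt₂ : ψ₁ 0 = derivWithin φ₂ (Ici 0) 0)
    (hcpt₃ : ψ₂ 0 = derivWithin φ₁ (Ici 0) 0) :
    ∃ ζ : E2 → ℝ,
      MemH52 quadrant ζ ∧ ContDiffOn ℝ 1 ζ (closure quadrant) ∧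
      (∀ t : ℝ, 0 ≤ t →
        ζ (EuclideanSpace.single 1 t) = φ₁ t ∧
        fderivWithin ℝ ζ (closure quadrant) (EuclideanSpace.single 1 t) (stdb2 0) = ψ₁ t) ∧
      (∀ t : ℝ, 0 ≤ t →
        ζ (EuclideanSpace.single 0 t) = φ₂ t ∧
        fderivWithin ℝ ζ (closure quadrant) (EuclideanSpace.single 0 t) (stdb2 1) = ψ₂ t) := by
  obtain ⟨χ, hχ, hχ0, hχ1⟩ := exists_chi
  have hP : ∀ A C : ℝ, Cc (fun t => A * χ t + C * (t * χ t)) := fun A C => (hχ.smulc A).add (hχ.idmul.smulc C)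
  have dP : ∀ A C : ℝ, deriv (fun t => A * χ t + C * (t * χ t)) 0 = C := by
    intro A C
    have := (((hχ.hasDerivAt 0).const_mul A).add ((((hasDerivAt_id (0:ℝ)).mul (hχ.hasDerivAt 0))).const_mul C)).deriv
    refine this.trans ?_
    simp [hχ0, hχ1]
  obtain ⟨p, p1, p2, p3, p4⟩ := corner (φ₁ 0) (ψ₁ 0) (ψ₂ 0) χ hχ hχ0 hχ1
  obtain ⟨u, u1, u2, u3, u4⟩ := core_half 0 1 (by simp) φ₁ φ₁' φ₁'' ψ₁ ψ₁' _ _ h₁ h₁' hc₁ hd₁ (hP (φ₁ 0) (ψ₂ 0)) (hχ.smulc (ψ₁ 0))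
    (by simp [hχ0]) (by rw [dP, hcpt₃]) (by simp [hχ0])
  obtain ⟨v, v1, v2, v3, v4⟩ := core_half 1 0 (by simp) φ₂ φ₂' φ₂'' ψ₂ ψ₂' _ _ h₂ h₂' hc₂ hd₂ (hP (φ₁ 0) (ψ₁ 0)) (hχ.smulc (ψ₂ 0))
    (by simp [hχ0, hcpt₁]) (by rw [dP, hcpt₂]) (by simp [hχ0])
  have cd : ContDiff ℝ 1 (fun x => (p x + u x) + v x) := (p2.add u2).add v2
  have fd : ∀ x w, fderiv ℝ (fun x => (p x + u x) + v x) x w = fderiv ℝ p x w + fderiv ℝ u x w + fderiv ℝ v x w := by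
    intro x w
    have a := (p2.differentiable (by simp) x).hasFDerivAt
    have b := (u2.differentiable (by simp) x).hasFDerivAt
    have c := (v2.differentiable (by simp) x).hasFDerivAt
    refine (congrArg (fun L : E2 →L[ℝ] ℝ => L w) ((a.add b).add c).fderiv).trans ?_
    simp
  refine ⟨fun x => (p x + u x) + v x, ((p1.add u1).add v1).memH52, cd.contDiffOn, ?_, ?_⟩
  · intro t ht
    have x0 : (EuclideanSpace.single 1 t : E2) 0 = 0 := by simp
    have x1 : (EuclideanSpace.single 1 t : E2) 1 = t := by simp
    simp only
    rw [fdw _ cd _ x0.ge (by rw [x1]; exact ht), fd, stdb2, (p3 _ x0).2, (u3 _ x0 (by rw [x1]; exact ht)).2,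
      (v4 _ x0 (by rw [x1]; exact ht)).2, (p3 _ x0).1, (u3 _ x0 (by rw [x1]; exact ht)).1,
      (v4 _ x0 (by rw [x1]; exact ht)).1, x1]
    constructor <;> ring
  · intro t ht
    have x0 : (EuclideanSpace.single 0 t : E2) 1 = 0 := by simp
    have x1 : (EuclideanSpace.single 0 t : E2) 0 = t := by simp
    simp only
    rw [fdw _ cd _ (by rw [x1]; exact ht) x0.ge, fd, stdb2, (p4 _ x0).2, (v3 _ x0 (by rw [x1]; exact ht)).2,
      (u4 _ x0 (by rw [x1]; exact ht)).2, (p4 _ x0).1, (v3 _ x0 (by rw [x1]; exact ht)).1,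
      (u4 _ x0 (by rw [x1]; exact ht)).1, x1]
    constructor <;> ring

end part14

theorem quadrant_inverse_trace
    (φ₁ ψ₁ φ₂ ψ₂ : ℝ → ℝ) (φ₁' φ₁'' φ₂' φ₂'' ψ₁' ψ₂' : ℝ → ℝ)
    -- (φᵢ, ψᵢ) ∈ H²(ℝ₊) × H¹(ℝ₊), with C¹ resp. C⁰ representatives up to the boundary
    (h₁ : MemH2halfline φ₁ φ₁' φ₁'') (h₂ : MemH2halfline φ₂ φ₂' φ₂'')
    (h₁' : MemH1halfline ψ₁ ψ₁') (h₂' : MemH1halfline ψ₂ ψ₂')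
    (hc₁ : ContDiffOn ℝ 1 φ₁ (Ici 0)) (hc₂ : ContDiffOn ℝ 1 φ₂ (Ici 0))
    (hd₁ : ContinuousOn ψ₁ (Ici 0)) (hd₂ : ContinuousOn ψ₂ (Ici 0))
    -- compatibility conditions (A.3)-(A.5)
    (hcpt₁ : φ₁ 0 = φ₂ 0)
    (hcpt₂ : ψ₁ 0 = derivWithin φ₂ (Ici 0) 0)
    (hcpt₃ : ψ₂ 0 = derivWithin φ₁ (Ici 0) 0) :
    ∃ ζ : E2 → ℝ,
      MemH52 quadrant ζ ∧ ContDiffOn ℝ 1 ζ (closure quadrant) ∧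
      -- (ζ, ∂ζ/∂x₁) = (φ₁, ψ₁) on {x₁ = 0}
      (∀ t : ℝ, 0 ≤ t →
        ζ (EuclideanSpace.single 1 t) = φ₁ t ∧
        fderivWithin ℝ ζ (closure quadrant) (EuclideanSpace.single 1 t) (stdb2 0) = ψ₁ t) ∧
      -- (ζ, ∂ζ/∂x₂) = (φ₂, ψ₂) on {x₂ = 0}
      (∀ t : ℝ, 0 ≤ t →
        ζ (EuclideanSpace.single 0 t) = φ₂ t ∧
        fderivWithin ℝ ζ (closure quadrant) (EuclideanSpace.single 0 t) (stdb2 1) = ψ₂ t) := by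
  exact quadrant_inverse_trace_aux φ₁ ψ₁ φ₂ ψ₂ φ₁' φ₁'' φ₂' φ₂'' ψ₁' ψ₂' h₁ h₂ h₁' h₂'
    hc₁ hc₂ hd₁ hd₂ hcpt₁ hcpt₂ hcpt₃
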